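/- Strict positivity on the subspace V₂: Assume a² ≥ 0, b², c² > 0, k = 1 or k = −1, and R ∈ (0,∞]. Let (u,v) be a profile solution on (0,R) with u > 0 and v < 0 on (0,R), and let Q be the associated k-radially symmetric map on B_R. Then L[Q](P) > 0 for every smooth compactly supported map P : B_R → S₀, not identically zero, all of whose matrix entries vanish identically except possibly the (1,3), (3,1), (2,3) and (3,2) entries. -/

import Mathlib

open Real MeasureTheory Filter Set Topology
open scoped ENNReal

noncomputable section

/-- `s₊ = (b² + √(b⁴ + 24 a² c²)) / (4c²)`, where `a2 = a²`, `b2 = b²`, `c2 = c²`. -/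
def sPlus (a2 b2 c2 : ℝ) : ℝ := (b2 + Real.sqrt (b2 ^ 2 + 24 * a2 * c2)) / (4 * c2)

/-- `h(p,q) = p(−a² + (2b²/√6)q + c²(p² + q²))`. -/
def hfun (a2 b2 c2 p q : ℝ) : ℝ :=
  p * (-a2 + 2 * b2 / Real.sqrt 6 * q + c2 * (p ^ 2 + q ^ 2))

/-- `g(p,q) = q(−a² − (b²/√6)q + c²(p² + q²)) + (b²/√6)p²`. -/
def gfun (a2 b2 c2 p q : ℝ) : ℝ :=
  q * (-a2 - b2 / Real.sqrt 6 * q + c2 * (p ^ 2 + q ^ 2)) + b2 / Real.sqrt 6 * p ^ 2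

/-- The interval `(0, R)` for `R ∈ (0,∞]`, as a subset of `ℝ`. -/
def Iset (R : ℝ≥0∞) : Set ℝ := {r : ℝ | 0 < r ∧ ENNReal.ofReal r < R}

/-- The filter of left-approach to the right endpoint `R`; `atTop` when `R = ∞`. -/
def endFilter (R : ℝ≥0∞) : Filter ℝ :=
  if R = ⊤ then Filter.atTop else nhdsWithin R.toReal (Set.Iio R.toReal)

/-- A profile solution on `(0,R)`: a C² pair `(u,v)` solving the radial ODE system with the
natural boundary conditions at `0` and at `R`. -/
structure ProfileSolution (a2 b2 c2 : ℝ) (k : ℤ) (R : ℝ≥0∞) (u v : ℝ → ℝ) : Prop where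
  smooth_u : ContDiffOn ℝ 2 u (Iset R)
  smooth_v : ContDiffOn ℝ 2 v (Iset R)
  ode_u : ∀ r ∈ Iset R,
    deriv (deriv u) r + deriv u r / r - (k : ℝ) ^ 2 / r ^ 2 * u r
      = hfun a2 b2 c2 (u r) (v r)
  ode_v : ∀ r ∈ Iset R,
    deriv (deriv v) r + deriv v r / r = gfun a2 b2 c2 (u r) (v r)
  bc0_u : Filter.Tendsto u (nhdsWithin 0 (Set.Ioi 0)) (nhds 0)
  bc0_v : Filter.Tendsto (deriv v) (nhdsWithin 0 (Set.Ioi 0)) (nhds 0)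
  bcR_u : Filter.Tendsto u (endFilter R) (nhds (sPlus a2 b2 c2 / Real.sqrt 2))
  bcR_v : Filter.Tendsto v (endFilter R) (nhds (-(sPlus a2 b2 c2 / Real.sqrt 6)))

/-- The matrix `e₃⊗e₃ − I₃/3`. -/
def E0base : Matrix (Fin 3) (Fin 3) ℝ :=
  !![-(1:ℝ)/3, 0, 0; 0, -1/3, 0; 0, 0, 2/3]

/-- The matrix `M_k(x)`, with upper-left 2×2 block `[[x₁, k x₂],[k x₂, −x₁]]` and all other
entries zero. -/
def Mk (k : ℤ) (x : EuclideanSpace ℝ (Fin 2)) : Matrix (Fin 3) (Fin 3) ℝ :=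
  !![x 0, (k : ℝ) * x 1, 0; (k : ℝ) * x 1, -(x 0), 0; 0, 0, 0]

open scoped Classical in
/-- The `k`-radially symmetric map associated with the profile `(u,v)`:
`Q(x) = (u(|x|)/(√2 |x|)) M_k(x) + v(|x|) √(3/2) (e₃⊗e₃ − I₃/3)` for `x ≠ 0`, and
`Q(0) = (lim_{r→0⁺} v(r)) √(3/2) (e₃⊗e₃ − I₃/3)`. -/
def Qmap (k : ℤ) (u v : ℝ → ℝ) (x : EuclideanSpace ℝ (Fin 2)) :
    Matrix (Fin 3) (Fin 3) ℝ :=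
  (u ‖x‖ / (Real.sqrt 2 * ‖x‖)) • Mk k x
    + (Real.sqrt (3 / 2) *
        (if x = 0 then limUnder (nhdsWithin 0 (Set.Ioi 0)) v else v ‖x‖)) • E0base

/-- The open disk `B_R ⊆ ℝ²` centered at the origin (all of `ℝ²` when `R = ∞`). -/
def ball2 (R : ℝ≥0∞) : Set (EuclideanSpace ℝ (Fin 2)) := {x | ENNReal.ofReal ‖x‖ < R}

/-- `|∇P|²`: the sum of squares of all first partial derivatives of the entries of `P`. -/
def gradSq (P : EuclideanSpace ℝ (Fin 2) → Matrix (Fin 3) (Fin 3) ℝ)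
    (x : EuclideanSpace ℝ (Fin 2)) : ℝ :=
  ∑ α : Fin 2, ∑ i : Fin 3, ∑ j : Fin 3,
    (fderiv ℝ (fun y => P y i j) x (EuclideanSpace.single α 1)) ^ 2

/-- The second variation of the Landau–de Gennes energy at `Q` in direction `P`:
`L[Q](P) = ∫_{B_R} (|∇P|² − a²|P|² − 2b² tr(P²Q) + c²(|Q|²|P|² + 2 tr(QP)²))`. -/
def Lform (a2 b2 c2 : ℝ) (R : ℝ≥0∞)
    (Q P : EuclideanSpace ℝ (Fin 2) → Matrix (Fin 3) (Fin 3) ℝ) : ℝ :=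
  ∫ x in ball2 R,
    (gradSq P x - a2 * (P x * P x).trace - 2 * b2 * (P x * P x * Q x).trace
      + c2 * ((Q x * Q x).trace * (P x * P x).trace + 2 * ((Q x * P x).trace) ^ 2))

/-- If `r (r ψ')' ≤ s² ψ` on `(0, r₀]` with `ψ > 0`, then `r₀ ψ'(r₀) ≤ s ψ(r₀)`. -/
theorem mul_deriv_le_of_euler_le {ψ ψ' ψ'' : ℝ → ℝ} {r₀ s : ℝ} (hr₀ : 0 < r₀) (hs : 0 ≤ s)
    (hpos : ∀ r ∈ Ioc 0 r₀, 0 < ψ r)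
    (h1 : ∀ r ∈ Ioc 0 r₀, HasDerivAt ψ (ψ' r) r)
    (h2 : ∀ r ∈ Ioc 0 r₀, HasDerivAt ψ' (ψ'' r) r)
    (hle : ∀ r ∈ Ioc 0 r₀, r ^ 2 * ψ'' r + r * ψ' r ≤ s ^ 2 * ψ r) :
    r₀ * ψ' r₀ ≤ s * ψ r₀ := by
  by_contra! hlt
  set G : ℝ → ℝ := fun r => r ^ s * (r * ψ' r - s * ψ r) with hG
  have hGd : ∀ r ∈ Ioc 0 r₀, HasDerivAt G
      (r ^ (s - 1) * (r ^ 2 * ψ'' r + r * ψ' r - s ^ 2 * ψ r)) r := by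
    intro r hr
    have e := (hasDerivAt_rpow_const (p := s) (Or.inl hr.1.ne')).mul
      (((hasDerivAt_id r).mul (h2 r hr)).sub ((h1 r hr).const_mul s))
    refine e.congr_deriv ?_
    have : r ^ s = r ^ (s - 1) * r := by
      rw [← rpow_add_one hr.1.ne']; ring_nf
    simp only [id, Pi.sub_apply, Pi.mul_apply]
    rw [this]; ring
  have hanti : AntitoneOn G (Ioc 0 r₀) := by
    refine antitoneOn_of_hasDerivWithinAt_nonpos (convex_Ioc 0 r₀)
      (fun r hr => (hGd r hr).continuousAt.continuousWithinAt)
      (fun r hr => (hGd r (interior_subset hr)).hasDerivWithinAt) ?_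
    intro r hr
    have hr := interior_subset hr
    have := hle r hr
    exact mul_nonpos_of_nonneg_of_nonpos (rpow_nonneg hr.1.le _) (by linarith)
  have hr₀m : r₀ ∈ Ioc 0 r₀ := ⟨hr₀, le_rfl⟩
  have hg : 0 < G r₀ := mul_pos (rpow_pos_of_pos hr₀ _) (by linarith)
  set c : ℝ := G r₀ * (r₀ ^ (2 * s))⁻¹ with hc
  have hcpos : 0 < c := mul_pos hg (inv_pos.2 (rpow_pos_of_pos hr₀ _))
  set H : ℝ → ℝ := fun r => r ^ (-s) * ψ r - c * Real.log r with hH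
  have hHd : ∀ r ∈ Ioc 0 r₀, HasDerivAt H
      (r⁻¹ * ((r ^ (2 * s))⁻¹ * G r - c)) r := by
    intro r hr
    have e := ((hasDerivAt_rpow_const (p := -s) (Or.inl hr.1.ne')).mul (h1 r hr)).sub
      ((Real.hasDerivAt_log hr.1.ne').const_mul c)
    refine e.congr_deriv ?_
    have hne := hr.1.ne'
    have e1 : r ^ (-s - 1) = (r ^ s)⁻¹ * r⁻¹ := by
      rw [rpow_sub_one hne, rpow_neg hr.1.le]; rfl
    have e2 : r ^ (2 * s) = r ^ s * r ^ s := by rw [two_mul, rpow_add hr.1]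
    have := (rpow_pos_of_pos hr.1 s).ne'
    rw [e1, e2, rpow_neg hr.1.le, hG]
    field_simp
    ring
  have hmono : MonotoneOn H (Ioc 0 r₀) := by
    refine monotoneOn_of_hasDerivWithinAt_nonneg (convex_Ioc 0 r₀)
      (fun r hr => (hHd r hr).continuousAt.continuousWithinAt)
      (fun r hr => (hHd r (interior_subset hr)).hasDerivWithinAt) ?_
    intro r hr
    have hr := interior_subset hr
    have hGr : G r₀ ≤ G r := hanti hr hr₀m hr.2
    refine mul_nonneg (inv_nonneg.2 hr.1.le) (sub_nonneg.2 ?_)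
    rw [hc, mul_comm]
    refine mul_le_mul ?_ hGr hg.le (inv_nonneg.2 (rpow_nonneg hr.1.le _))
    exact inv_anti₀ (rpow_pos_of_pos hr.1 _) (rpow_le_rpow hr.1.le hr.2 (by linarith))
  set K : ℝ := r₀ ^ (-s) * ψ r₀ with hK
  have hKpos : 0 < K := mul_pos (rpow_pos_of_pos hr₀ _) (hpos _ hr₀m)
  set r := r₀ * Real.exp (-(K / c)) with hr
  have hrm : r ∈ Ioc 0 r₀ := by
    refine ⟨by positivity, ?_⟩
    have : Real.exp (-(K / c)) ≤ 1 := Real.exp_le_one_iff.2 (by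
      have : 0 < K / c := by positivity
      linarith)
    nlinarith
  have := hmono hrm hr₀m hrm.2
  have hlog : Real.log r = Real.log r₀ - K / c := by
    rw [hr, Real.log_mul hr₀.ne' (Real.exp_pos _).ne', Real.log_exp]; ring
  have hp : 0 < r ^ (-s) * ψ r := mul_pos (rpow_pos_of_pos hrm.1 _) (hpos _ hrm)
  simp only [hH, hlog] at this
  have : c * (K / c) = K := by field_simp
  nlinarith

/-- The mean of a function over the circle, parametrised by `(-π, π]`. -/
def circAvg (f : ℝ → ℝ) : ℝ := (2 * π)⁻¹ * ∫ θ in (-π)..π, f θ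

theorem circAvg_add {f g : ℝ → ℝ} (hf : Continuous f) (hg : Continuous g) :
    circAvg (fun θ => f θ + g θ) = circAvg f + circAvg g := by
  simp only [circAvg]
  rw [intervalIntegral.integral_add (hf.intervalIntegrable _ _) (hg.intervalIntegrable _ _)]
  ring

theorem circAvg_sub {f g : ℝ → ℝ} (hf : Continuous f) (hg : Continuous g) :
    circAvg (fun θ => f θ - g θ) = circAvg f - circAvg g := by
  simp only [circAvg]
  rw [intervalIntegral.integral_sub (hf.intervalIntegrable _ _) (hg.intervalIntegrable _ _)]
  ring

theorem circAvg_const_mul (c : ℝ) (f : ℝ → ℝ) :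
    circAvg (fun θ => c * f θ) = c * circAvg f := by
  simp only [circAvg, intervalIntegral.integral_const_mul]
  ring

theorem circAvg_const (c : ℝ) : circAvg (fun _ => c) = c := by
  simp only [circAvg, intervalIntegral.integral_const, smul_eq_mul]
  have := pi_pos.ne'
  field_simp
  ring

theorem circAvg_nonneg {f : ℝ → ℝ} (hf : ∀ θ, 0 ≤ f θ) : 0 ≤ circAvg f := by
  have : -π ≤ π := by linarith [pi_pos]
  exact mul_nonneg (by positivity) (intervalIntegral.integral_nonneg this fun θ _ => hf θ)

theorem circAvg_cos : circAvg cos = 0 := by simp [circAvg]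

theorem circAvg_sin : circAvg sin = 0 := by simp [circAvg]

/-- Wirtinger's inequality on the circle. -/
theorem circAvg_sq_sub_sq_circAvg_le {f f' : ℝ → ℝ} (hf : ∀ θ, HasDerivAt f (f' θ) θ)
    (hf' : Continuous f') (hper : f π = f (-π)) :
    circAvg (fun θ => f θ ^ 2) - circAvg f ^ 2 ≤ circAvg (fun θ => f' θ ^ 2) := by
  have hab : -π < π := by linarith [pi_pos]
  have hfc : Continuous f := continuous_iff_continuousAt.2 fun θ => (hf θ).continuousAt
  have mem : ∀ g : ℝ → ℝ, Continuous g →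
      MemLp (fun θ => (g θ : ℂ)) 2 (volume.restrict (Ioc (-π) π)) := by
    intro g hg
    have : Continuous fun θ => (g θ : ℂ) := by fun_prop
    obtain ⟨C, hC⟩ := isCompact_Icc.exists_bound_of_continuousOn
      (s := Icc (-π) π) this.continuousOn
    exact MemLp.of_bound this.aestronglyMeasurable C
      ((ae_restrict_mem measurableSet_Ioc).mono fun θ hθ => hC θ (Ioc_subset_Icc_self hθ))
  have hs := hasSum_sq_fourierCoeffOn hab (mem f hfc)
  have hs' := hasSum_sq_fourierCoeffOn hab (mem f' hf')
  have conv : ∀ g : ℝ → ℝ, (π - -π)⁻¹ • ∫ θ in (-π)..π, ‖(g θ : ℂ)‖ ^ 2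
      = circAvg (fun θ => g θ ^ 2) := by
    intro g
    simp only [circAvg, smul_eq_mul, Complex.norm_real, norm_eq_abs, sq_abs]
    ring_nf
  rw [conv] at hs hs'
  have h0 : ‖fourierCoeffOn hab (fun θ => (f θ : ℂ)) 0‖ ^ 2 = circAvg f ^ 2 := by
    rw [fourierCoeffOn_eq_integral]
    simp only [neg_zero, fourier_zero, one_smul]
    rw [intervalIntegral.integral_ofReal, norm_smul, Complex.norm_real, mul_pow, circAvg, mul_pow]
    simp only [norm_eq_abs, sq_abs]
    congr 2
    field_simp
    ring
  have hn : ∀ n : ℤ, n ≠ 0 → ‖fourierCoeffOn hab (fun θ => (f θ : ℂ)) n‖ ^ 2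
      ≤ ‖fourierCoeffOn hab (fun θ => (f' θ : ℂ)) n‖ ^ 2 := by
    intro n hn
    rw [fourierCoeffOn_of_hasDerivAt hab hn (f := fun θ => (f θ : ℂ)) (f' := fun θ => (f' θ : ℂ))
      (fun x _ => (hf x).ofReal_comp)
      ((by fun_prop : Continuous fun θ => (f' θ : ℂ)).intervalIntegrable _ _)]
    rw [hper, sub_self, mul_zero, zero_sub]
    have hn1 : (1 : ℝ) ≤ |(n : ℝ)| := by exact_mod_cast Int.one_le_abs hn
    have e : ‖(1 : ℂ) / (-2 * π * Complex.I * n)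
        * -((((π : ℝ) : ℂ) - ((-π : ℝ) : ℂ)) * fourierCoeffOn hab (fun θ => (f' θ : ℂ)) n)‖
        = |(n : ℝ)|⁻¹ * ‖fourierCoeffOn hab (fun θ => (f' θ : ℂ)) n‖ := by
      have h2 : ((π : ℝ) : ℂ) - ((-π : ℝ) : ℂ) = ((2 * π : ℝ) : ℂ) := by push_cast; ring
      rw [h2, norm_mul, norm_neg, norm_mul, Complex.norm_real, norm_div, norm_mul, norm_mul,
        norm_mul]
      have hp := pi_pos
      have : (0:ℝ) < |(n : ℝ)| := by linarith
      simp [abs_of_pos hp]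
      field_simp
    rw [e]
    refine pow_le_pow_left₀ (by positivity) ?_ 2
    exact mul_le_of_le_one_left (norm_nonneg _) (inv_le_one_of_one_le₀ hn1)
  have hupd := (hs.update 0 (0 : ℝ))
  have hle := hasSum_le (fun n => ?_) hupd hs'
  · rw [h0] at hle; linarith
  · by_cases h : n = 0
    · subst h; simp
    · simp only [Function.update_of_ne h]; exact hn n h

/-- Differentiation under the circle mean. -/
theorem hasDerivAt_circAvg {f f' : ℝ → ℝ → ℝ} (hf : ∀ r, Continuous (f r))
    (hf' : Continuous fun x : ℝ × ℝ => f' x.1 x.2)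
    (hd : ∀ r θ, HasDerivAt (fun r => f r θ) (f' r θ) r) (r : ℝ) :
    HasDerivAt (fun r => circAvg (f r)) (circAvg (f' r)) r := by
  obtain ⟨C, hC⟩ := ((isCompact_Icc (a := r - 1) (b := r + 1)).prod
    (isCompact_Icc (a := -π) (b := π))).exists_bound_of_continuousOn hf'.continuousOn
  have hab : -π ≤ π := by linarith [pi_pos]
  refine HasDerivAt.const_mul _ (intervalIntegral.hasDerivAt_integral_of_dominated_loc_of_deriv_le
    (s := Icc (r - 1) (r + 1)) (bound := fun _ => C) (Icc_mem_nhds (by linarith) (by linarith))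
    (Eventually.of_forall fun r => (hf r).aestronglyMeasurable)
    ((hf r).intervalIntegrable _ _)
    (by
      have : Continuous (f' r) := hf'.comp (by fun_prop : Continuous fun θ => (r, θ))
      exact this.aestronglyMeasurable)
    ?_ (by simp) ?_).2
  · refine Eventually.of_forall fun θ hθ x hx => ?_
    rw [uIoc_of_le hab] at hθ
    exact hC (x, θ) ⟨hx, hθ.1.le, hθ.2⟩
  · exact Eventually.of_forall fun θ _ x _ => hd x θ

theorem continuous_circAvg {f : ℝ → ℝ → ℝ} (hf : Continuous fun x : ℝ × ℝ => f x.1 x.2) :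
    Continuous fun r => circAvg (f r) :=
  continuous_const.mul
    (intervalIntegral.continuous_parametric_intervalIntegral_of_continuous' hf _ _)

/-- Real part of the mean of `(f + i g) e^{-ikθ}`. -/
def modeRe (k : ℝ) (f g : ℝ → ℝ) : ℝ := circAvg fun θ => f θ * cos θ + k * (g θ * sin θ)

/-- Imaginary part of the mean of `(f + i g) e^{-ikθ}`. -/
def modeIm (k : ℝ) (f g : ℝ → ℝ) : ℝ := circAvg fun θ => g θ * cos θ - k * (f θ * sin θ)

/-- Mean of the real part of `(f + i g)² e^{-ikθ}`. -/
def modeSq (k : ℝ) (f g : ℝ → ℝ) : ℝ :=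
  circAvg fun θ => cos θ * (f θ ^ 2 - g θ ^ 2) + 2 * k * (sin θ * (f θ * g θ))

theorem abs_cos_mul_add_sin_mul_le {k : ℝ} (hk : k = 1 ∨ k = -1) (θ x y : ℝ) :
    |cos θ * (x ^ 2 - y ^ 2) + 2 * k * (sin θ * (x * y))| ≤ x ^ 2 + y ^ 2 := by
  refine abs_le_of_sq_le_sq ?_ (by positivity)
  have h := cos_sq_add_sin_sq θ
  rcases hk with rfl | rfl
  · nlinarith [sq_nonneg (sin θ * (x ^ 2 - y ^ 2) - 2 * cos θ * (x * y))]
  · nlinarith [sq_nonneg (sin θ * (x ^ 2 - y ^ 2) + 2 * cos θ * (x * y))]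

/-- After removal of the modes `1` and `e^{ikθ}` the quadratic coupling is controlled by the
remaining mass. -/
theorem sign_mul_modeSq_sub_le {k ς : ℝ} (hk : k = 1 ∨ k = -1) (hς : ς = 1 ∨ ς = -1)
    {f g : ℝ → ℝ} (hf : Continuous f) (hg : Continuous g) :
    ς * (modeSq k f g - 2 * (circAvg f * modeRe k f g - circAvg g * modeIm k f g)) ≤
      circAvg (fun θ => f θ ^ 2 + g θ ^ 2) - circAvg f ^ 2 - circAvg g ^ 2
        - modeRe k f g ^ 2 - modeIm k f g ^ 2 := by
  set a0 := circAvg f with ha0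
  set b0 := circAvg g with hb0
  set a1 := modeRe k f g with ha1
  set b1 := modeIm k f g with hb1
  have hk2 : k ^ 2 = 1 := by rcases hk with rfl | rfl <;> norm_num
  have key : 0 ≤ circAvg (fun θ => (f θ ^ 2 + g θ ^ 2)
      + (-ς * (cos θ * (f θ ^ 2 - g θ ^ 2) + 2 * k * (sin θ * (f θ * g θ)))
      + ((a0 ^ 2 + b0 ^ 2 + a1 ^ 2 + b1 ^ 2 - 2 * ς * (a0 * a1 - b0 * b1))
      + ((2 * (a0 * a1 + b0 * b1) - ς * (a0 ^ 2 - b0 ^ 2 + a1 ^ 2 - b1 ^ 2)) * cos θ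
      + ((2 * k * (b0 * a1 - a0 * b1) - ς * (2 * k * a0 * b0 - 2 * k * a1 * b1)) * sin θ
      + ((-2 * a0 + 2 * ς * a1) * f θ
      + ((-2 * b0 - 2 * ς * b1) * g θ
      + ((-2 * a1 + 2 * ς * a0) * (f θ * cos θ + k * (g θ * sin θ))
      + (-2 * b1 - 2 * ς * b0) * (g θ * cos θ - k * (f θ * sin θ)))))))))) := by
    refine circAvg_nonneg fun θ => ?_
    have h := abs_le.1 (abs_cos_mul_add_sin_mul_le hk θ
      (f θ - a0 - (a1 * cos θ - k * b1 * sin θ)) (g θ - b0 - (b1 * cos θ + k * a1 * sin θ)))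
    have hcs := cos_sq_add_sin_sq θ
    set z1 := f θ - a0 - (a1 * cos θ - k * b1 * sin θ) with hz1
    set z2 := g θ - b0 - (b1 * cos θ + k * a1 * sin θ) with hz2
    have h' : 0 ≤ (z1 ^ 2 + z2 ^ 2)
        - ς * (cos θ * (z1 ^ 2 - z2 ^ 2) + 2 * k * (sin θ * (z1 * z2))) := by
      rcases hς with rfl | rfl <;> linarith
    refine h'.trans_eq ?_
    rw [hz1, hz2]
    rcases hk with rfl | rfl
    · linear_combination ((a1 ^ 2 + b1 ^ 2) - ς * ((a1 ^ 2 - b1 ^ 2) * cos θ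
        - 2 * 1 * a1 * b1 * sin θ - 2 * (a1 * f θ - b1 * g θ) + 2 * (a0 * a1 - b0 * b1))) * hcs
    · linear_combination ((a1 ^ 2 + b1 ^ 2) - ς * ((a1 ^ 2 - b1 ^ 2) * cos θ
        - 2 * (-1) * a1 * b1 * sin θ - 2 * (a1 * f θ - b1 * g θ) + 2 * (a0 * a1 - b0 * b1))) * hcs
  rw [circAvg_add (f := fun θ => f θ ^ 2 + g θ ^ 2) (by fun_prop) (by fun_prop)] at key
  generalize circAvg (fun θ => f θ ^ 2 + g θ ^ 2) = M at key ⊢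
  rw [circAvg_add, circAvg_add, circAvg_add, circAvg_add, circAvg_add, circAvg_add, circAvg_add,
    circAvg_const] at key
  · simp only [circAvg_const_mul] at key
    rw [circAvg_cos, circAvg_sin] at key
    change 0 ≤ _ + (-ς * modeSq k f g + (_ + (_ + (_ + (_ * a0 + (_ * b0
      + (_ * a1 + _ * b1))))))) at key
    nlinarith [key]
  all_goals fun_prop

theorem modeSq_sub_le {k : ℝ} (hk : k = 1 ∨ k = -1)
    {f g : ℝ → ℝ} (hf : Continuous f) (hg : Continuous g) :
    modeSq k f g - 2 * (circAvg f * modeRe k f g - circAvg g * modeIm k f g) ≤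
      circAvg (fun θ => f θ ^ 2 + g θ ^ 2) - circAvg f ^ 2 - circAvg g ^ 2
        - modeRe k f g ^ 2 - modeIm k f g ^ 2 := by
  simpa using sign_mul_modeSq_sub_le hk (Or.inl rfl) hf hg

/-- Bessel's inequality for the modes `1` and `e^{ikθ}`. -/
theorem modes_sq_le {k : ℝ} (hk : k = 1 ∨ k = -1)
    {f g : ℝ → ℝ} (hf : Continuous f) (hg : Continuous g) :
    circAvg f ^ 2 + circAvg g ^ 2 + modeRe k f g ^ 2 + modeIm k f g ^ 2 ≤
      circAvg (fun θ => f θ ^ 2 + g θ ^ 2) := by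
  have h1 := sign_mul_modeSq_sub_le hk (Or.inl rfl) hf hg
  have h2 := sign_mul_modeSq_sub_le hk (Or.inr rfl) hf hg
  linarith

/-- Bessel's inequality applied to `(f' - ρ f, g' - ρ g)`. -/
theorem modes_sub_sq_le {k : ℝ} (hk : k = 1 ∨ k = -1) (ρ : ℝ)
    {f g f' g' : ℝ → ℝ} (hf : Continuous f) (hg : Continuous g) (hf' : Continuous f')
    (hg' : Continuous g') :
    (circAvg f' - ρ * circAvg f) ^ 2 + (circAvg g' - ρ * circAvg g) ^ 2
      + (modeRe k f' g' - ρ * modeRe k f g) ^ 2 + (modeIm k f' g' - ρ * modeIm k f g) ^ 2 ≤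
      circAvg (fun θ => f' θ ^ 2 + g' θ ^ 2)
        - ρ * circAvg (fun θ => 2 * (f θ * f' θ + g θ * g' θ))
        + ρ ^ 2 * circAvg (fun θ => f θ ^ 2 + g θ ^ 2) := by
  have h := modes_sq_le hk (f := fun θ => f' θ - ρ * f θ) (g := fun θ => g' θ - ρ * g θ)
    (by fun_prop) (by fun_prop)
  have e0 : circAvg (fun θ => f' θ - ρ * f θ) = circAvg f' - ρ * circAvg f := by
    rw [circAvg_sub hf' (by fun_prop), circAvg_const_mul]
  have e1 : circAvg (fun θ => g' θ - ρ * g θ) = circAvg g' - ρ * circAvg g := by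
    rw [circAvg_sub hg' (by fun_prop), circAvg_const_mul]
  have e2 : modeRe k (fun θ => f' θ - ρ * f θ) (fun θ => g' θ - ρ * g θ)
      = modeRe k f' g' - ρ * modeRe k f g := by
    simp only [modeRe]
    rw [← circAvg_const_mul, ← circAvg_sub (by fun_prop) (by fun_prop)]
    congr 1; ext θ; ring
  have e3 : modeIm k (fun θ => f' θ - ρ * f θ) (fun θ => g' θ - ρ * g θ)
      = modeIm k f' g' - ρ * modeIm k f g := by
    simp only [modeIm]
    rw [← circAvg_const_mul, ← circAvg_sub (by fun_prop) (by fun_prop)]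
    congr 1; ext θ; ring
  have e4 : circAvg (fun θ => (f' θ - ρ * f θ) ^ 2 + (g' θ - ρ * g θ) ^ 2)
      = circAvg (fun θ => f' θ ^ 2 + g' θ ^ 2)
        - ρ * circAvg (fun θ => 2 * (f θ * f' θ + g θ * g' θ))
        + ρ ^ 2 * circAvg (fun θ => f θ ^ 2 + g θ ^ 2) := by
    rw [← circAvg_const_mul, ← circAvg_const_mul, ← circAvg_sub (by fun_prop) (by fun_prop),
      ← circAvg_add (by fun_prop) (by fun_prop)]
    congr 1; ext θ; ring
  rwa [e0, e1, e2, e3, e4] at h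

/-- The pointwise (in the radius) comparison of the angular energy with the derivative of the
boundary flux, as an inequality between real numbers. -/
theorem flux_deriv_add_le {r ρ₀ ρ₁ V κ τ M M' A C K a₀ b₀ a₁ b₁ a₀' b₀' a₁' b₁' : ℝ}
    (hr : 0 < r) (hκ : 0 ≤ κ) (hτ : 0 < τ)
    (hA : (a₀' - (ρ₀ + ρ₁) / 2 * a₀) ^ 2 + (b₀' - (ρ₀ + ρ₁) / 2 * b₀) ^ 2
      + (a₁' - (ρ₀ + ρ₁) / 2 * a₁) ^ 2 + (b₁' - (ρ₀ + ρ₁) / 2 * b₁) ^ 2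
      ≤ A - (ρ₀ + ρ₁) / 2 * M' + ((ρ₀ + ρ₁) / 2) ^ 2 * M)
    (hM : a₀ ^ 2 + b₀ ^ 2 + a₁ ^ 2 + b₁ ^ 2 ≤ M)
    (hK : K - 2 * (a₀ * a₁ - b₀ * b₁) ≤ M - a₀ ^ 2 - b₀ ^ 2 - a₁ ^ 2 - b₁ ^ 2)
    (hC : M - a₀ ^ 2 - b₀ ^ 2 ≤ C) :
    (r * (V - κ * τ - ρ₀ ^ 2) * ((M + (a₀ ^ 2 + b₀ ^ 2) - (a₁ ^ 2 + b₁ ^ 2)) / 2)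
      + r * ρ₀ * ((M' + (2 * a₀ * a₀' + 2 * b₀ * b₀') - (2 * a₁ * a₁' + 2 * b₁ * b₁')) / 2)
      + (r * (V + 1 / r ^ 2 - κ / τ - ρ₁ ^ 2)
          * ((M - (a₀ ^ 2 + b₀ ^ 2) + (a₁ ^ 2 + b₁ ^ 2)) / 2)
        + r * ρ₁ * ((M' - (2 * a₀ * a₀' + 2 * b₀ * b₀') + (2 * a₁ * a₁' + 2 * b₁ * b₁')) / 2)))
      + r * ((a₀' - ρ₀ * a₀) ^ 2 + (b₀' - ρ₀ * b₀) ^ 2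
        + (a₁' - ρ₁ * a₁) ^ 2 + (b₁' - ρ₁ * b₁) ^ 2
        + (M - a₀ ^ 2 - b₀ ^ 2 - a₁ ^ 2 - b₁ ^ 2) / 2 / r ^ 2)
      ≤ r * A + C / r + r * V * M - r * κ * K := by
  set Y := M - a₀ ^ 2 - b₀ ^ 2 - a₁ ^ 2 - b₁ ^ 2 with hY
  have hY0 : 0 ≤ Y := by linarith
  have hτ2 : 2 ≤ τ + 1 / τ := by
    have : τ + 1 / τ - 2 = (τ - 1) ^ 2 / τ := by field_simp; ring
    have : 0 ≤ (τ - 1) ^ 2 / τ := by positivity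
    linarith
  have hcross : 2 * (a₀ * a₁ - b₀ * b₁) ≤ τ * (a₀ ^ 2 + b₀ ^ 2) + (a₁ ^ 2 + b₁ ^ 2) / τ := by
    have e : τ * (a₀ ^ 2 + b₀ ^ 2) + (a₁ ^ 2 + b₁ ^ 2) / τ - 2 * (a₀ * a₁ - b₀ * b₁)
        = ((τ * a₀ - a₁) ^ 2 + (τ * b₀ + b₁) ^ 2) / τ := by field_simp; ring
    have : 0 ≤ ((τ * a₀ - a₁) ^ 2 + (τ * b₀ + b₁) ^ 2) / τ := by positivity
    linarith
  have hpot : 0 ≤ κ * (τ * (a₀ ^ 2 + b₀ ^ 2) + (a₁ ^ 2 + b₁ ^ 2) / τ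
      + (τ + 1 / τ) / 2 * Y - K) := by
    refine mul_nonneg hκ ?_
    nlinarith
  have hdiff : 0 ≤ A - (ρ₀ + ρ₁) / 2 * M' + ((ρ₀ + ρ₁) / 2) ^ 2 * M
      - ((a₀' - (ρ₀ + ρ₁) / 2 * a₀) ^ 2 + (b₀' - (ρ₀ + ρ₁) / 2 * b₀) ^ 2
      + (a₁' - (ρ₀ + ρ₁) / 2 * a₁) ^ 2 + (b₁' - (ρ₀ + ρ₁) / 2 * b₁) ^ 2) := by linarith
  have hang : 0 ≤ (C - (M - a₀ ^ 2 - b₀ ^ 2)) / r ^ 2 :=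
    div_nonneg (by linarith) (by positivity)
  have hδ : 0 ≤ ((ρ₀ - ρ₁) / 2) ^ 2 * Y := by positivity
  have hsum := mul_nonneg hr.le (add_nonneg (add_nonneg hpot hdiff) (add_nonneg hang hδ))
  rw [← sub_nonneg]
  refine hsum.trans_eq ?_
  rw [hY]
  field_simp
  ring

/-- A `C¹` function on the plane read in polar coordinates `(r, θ)`, with its partial
derivatives. -/
structure PolarField (p pr pt : ℝ → ℝ → ℝ) : Prop where
  cont : Continuous fun x : ℝ × ℝ => p x.1 x.2
  cont_r : Continuous fun x : ℝ × ℝ => pr x.1 x.2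
  cont_t : Continuous fun x : ℝ × ℝ => pt x.1 x.2
  deriv_r : ∀ r θ, HasDerivAt (fun r => p r θ) (pr r θ) r
  deriv_t : ∀ r θ, HasDerivAt (p r) (pt r θ) θ
  periodic : ∀ r, p r π = p r (-π)
  center : ∀ θ, p 0 θ = p 0 0

namespace PolarField

variable {p pr pt : ℝ → ℝ → ℝ}

theorem cont_slice (h : PolarField p pr pt) (r : ℝ) : Continuous (p r) :=
  h.cont.comp (by fun_prop : Continuous fun θ => (r, θ))

theorem cont_r_slice (h : PolarField p pr pt) (r : ℝ) : Continuous (pr r) :=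
  h.cont_r.comp (by fun_prop : Continuous fun θ => (r, θ))

theorem cont_t_slice (h : PolarField p pr pt) (r : ℝ) : Continuous (pt r) :=
  h.cont_t.comp (by fun_prop : Continuous fun θ => (r, θ))

end PolarField

/-- The angular integral (up to the factor `2π`) of the energy density of `(p, q)` in polar
coordinates, including the Jacobian `r`. -/
def angularEnergy (k : ℝ) (V κ : ℝ → ℝ) (p pr pt q qr qt : ℝ → ℝ → ℝ) (r : ℝ) : ℝ :=
  r * circAvg (fun θ => pr r θ ^ 2 + qr r θ ^ 2) + circAvg (fun θ => pt r θ ^ 2 + qt r θ ^ 2) / r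
    + r * V r * circAvg (fun θ => p r θ ^ 2 + q r θ ^ 2) - r * κ r * modeSq k (p r) (q r)

theorem hasDerivAt_logDeriv {ψ ψ' ψ'' : ℝ → ℝ} {r W : ℝ} (hr : 0 < r) (hψ : ψ r ≠ 0)
    (h1 : HasDerivAt ψ (ψ' r) r) (h2 : HasDerivAt ψ' (ψ'' r) r)
    (hW : r ^ 2 * ψ'' r + r * ψ' r = r ^ 2 * (W * ψ r)) :
    HasDerivAt (fun r => r * (ψ' r / ψ r)) (r * (W - (ψ' r / ψ r) ^ 2)) r := by
  refine ((hasDerivAt_id r).mul (h2.div h1 hψ)).congr_deriv ?_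
  have : ψ'' r = W * ψ r - ψ' r / r := by
    field_simp
    refine mul_left_cancel₀ hr.ne' ?_
    linear_combination hW
  simp only [id, Pi.div_apply, this]
  field_simp
  ring

/-- Strict positivity of the quadratic form in polar coordinates, given a positive solution
`(ψ₀, ψ₁)` of the cooperative system formed by the modes `1` and `e^{ikθ}`. -/
theorem integral_angularEnergy_pos {k : ℝ} (hk : k = 1 ∨ k = -1) {R₁ δ D : ℝ} (hδ : 0 < δ)
    (hδR : δ ≤ R₁) (hD : 0 ≤ D) {V κ : ℝ → ℝ} {ψ₀ ψ₀' ψ₀'' ψ₁ ψ₁' ψ₁'' : ℝ → ℝ}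
    {p pr pt q qr qt : ℝ → ℝ → ℝ} (hp : PolarField p pr pt) (hq : PolarField q qr qt)
    (hVc : ContinuousOn V (Ioo 0 R₁)) (hκc : ContinuousOn κ (Ioo 0 R₁))
    (hV : ∀ r ∈ Ioc 0 δ, V r ≤ D) (hκ : ∀ r ∈ Ioc 0 R₁, 0 ≤ κ r)
    (pos₀ : ∀ r ∈ Ioc 0 R₁, 0 < ψ₀ r) (pos₁ : ∀ r ∈ Ioc 0 R₁, 0 < ψ₁ r)
    (d₀ : ∀ r ∈ Ioc 0 R₁, HasDerivAt ψ₀ (ψ₀' r) r)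
    (d₁ : ∀ r ∈ Ioc 0 R₁, HasDerivAt ψ₁ (ψ₁' r) r)
    (dd₀ : ∀ r ∈ Ioc 0 R₁, HasDerivAt ψ₀' (ψ₀'' r) r)
    (dd₁ : ∀ r ∈ Ioc 0 R₁, HasDerivAt ψ₁' (ψ₁'' r) r)
    (ode₀ : ∀ r ∈ Ioc 0 R₁,
      r ^ 2 * ψ₀'' r + r * ψ₀' r = r ^ 2 * (V r * ψ₀ r - κ r * ψ₁ r))
    (ode₁ : ∀ r ∈ Ioc 0 R₁,
      r ^ 2 * ψ₁'' r + r * ψ₁' r = ψ₁ r + r ^ 2 * (V r * ψ₁ r - κ r * ψ₀ r))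
    (hint : IntervalIntegrable (angularEnergy k V κ p pr pt q qr qt) volume 0 R₁)
    (hp0 : ∀ θ, p R₁ θ = 0) (hq0 : ∀ θ, q R₁ θ = 0)
    (hne : ∃ r ∈ Ioo 0 R₁, 0 < circAvg fun θ => p r θ ^ 2 + q r θ ^ 2) :
    0 < ∫ r in (0 : ℝ)..R₁, angularEnergy k V κ p pr pt q qr qt r := by
  have hR₁ : 0 < R₁ := hδ.trans_le hδR
  set E := angularEnergy k V κ p pr pt q qr qt with hE
  have cp := hp.cont
  have cq := hq.cont
  have cpr := hp.cont_r
  have cqr := hq.cont_r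
  have cpt := hp.cont_t
  have cqt := hq.cont_t
  set M : ℝ → ℝ := fun r => circAvg fun θ => p r θ ^ 2 + q r θ ^ 2 with hM
  set M' : ℝ → ℝ := fun r => circAvg fun θ => 2 * (p r θ * pr r θ + q r θ * qr r θ) with hM'
  set a₀ : ℝ → ℝ := fun r => circAvg (p r) with ha₀
  set b₀ : ℝ → ℝ := fun r => circAvg (q r) with hb₀
  set a₁ : ℝ → ℝ := fun r => modeRe k (p r) (q r) with ha₁
  set b₁ : ℝ → ℝ := fun r => modeIm k (p r) (q r) with hb₁
  set a₀' : ℝ → ℝ := fun r => circAvg (pr r) with ha₀'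
  set b₀' : ℝ → ℝ := fun r => circAvg (qr r) with hb₀'
  set a₁' : ℝ → ℝ := fun r => modeRe k (pr r) (qr r) with ha₁'
  set b₁' : ℝ → ℝ := fun r => modeIm k (pr r) (qr r) with hb₁'
  have dM : ∀ r, HasDerivAt M (M' r) r := by
    intro r
    refine hasDerivAt_circAvg (f := fun r θ => p r θ ^ 2 + q r θ ^ 2)
      (f' := fun r θ => 2 * (p r θ * pr r θ + q r θ * qr r θ)) (fun r => ?_)
      (by fun_prop) (fun r θ => ?_) r
    · exact ((hp.cont_slice r).pow 2).add ((hq.cont_slice r).pow 2)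
    · exact (((hp.deriv_r r θ).pow 2).add ((hq.deriv_r r θ).pow 2)).congr_deriv (by
        simp; ring)
  have da₀ : ∀ r, HasDerivAt a₀ (a₀' r) r := hasDerivAt_circAvg hp.cont_slice cpr hp.deriv_r
  have db₀ : ∀ r, HasDerivAt b₀ (b₀' r) r := hasDerivAt_circAvg hq.cont_slice cqr hq.deriv_r
  have da₁ : ∀ r, HasDerivAt a₁ (a₁' r) r := by
    refine hasDerivAt_circAvg (f := fun r θ => p r θ * cos θ + k * (q r θ * sin θ))
      (f' := fun r θ => pr r θ * cos θ + k * (qr r θ * sin θ)) (fun r => ?_) (by fun_prop)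
      (fun r θ => ?_)
    · have := hp.cont_slice r
      have := hq.cont_slice r
      fun_prop
    · exact ((hp.deriv_r r θ).mul_const _).add (((hq.deriv_r r θ).mul_const _).const_mul k)
  have db₁ : ∀ r, HasDerivAt b₁ (b₁' r) r := by
    refine hasDerivAt_circAvg (f := fun r θ => q r θ * cos θ - k * (p r θ * sin θ))
      (f' := fun r θ => qr r θ * cos θ - k * (pr r θ * sin θ)) (fun r => ?_) (by fun_prop)
      (fun r θ => ?_)
    · have := hp.cont_slice r
      have := hq.cont_slice r
      fun_prop
    · exact ((hq.deriv_r r θ).mul_const _).sub (((hp.deriv_r r θ).mul_const _).const_mul k)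
  set Z₀ : ℝ → ℝ := fun r => (M r + (a₀ r ^ 2 + b₀ r ^ 2) - (a₁ r ^ 2 + b₁ r ^ 2)) / 2 with hZ₀
  set Z₁ : ℝ → ℝ := fun r => (M r - (a₀ r ^ 2 + b₀ r ^ 2) + (a₁ r ^ 2 + b₁ r ^ 2)) / 2 with hZ₁
  have hbessel : ∀ r, a₀ r ^ 2 + b₀ r ^ 2 + a₁ r ^ 2 + b₁ r ^ 2 ≤ M r := fun r =>
    modes_sq_le hk (hp.cont_slice r) (hq.cont_slice r)
  have hZ₀0 : ∀ r, 0 ≤ Z₀ r := fun r => by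
    have := hbessel r
    simp only [hZ₀]
    nlinarith [sq_nonneg (a₀ r), sq_nonneg (b₀ r)]
  have hZ₁0 : ∀ r, 0 ≤ Z₁ r := fun r => by
    have := hbessel r
    simp only [hZ₁]
    nlinarith [sq_nonneg (a₁ r), sq_nonneg (b₁ r)]
  have hX₀ : ∀ r, HasDerivAt (fun r => a₀ r ^ 2 + b₀ r ^ 2)
      (2 * a₀ r * a₀' r + 2 * b₀ r * b₀' r) r := fun r =>
    (((da₀ r).pow 2).add ((db₀ r).pow 2)).congr_deriv (by simp)
  have hX₁ : ∀ r, HasDerivAt (fun r => a₁ r ^ 2 + b₁ r ^ 2)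
      (2 * a₁ r * a₁' r + 2 * b₁ r * b₁' r) r := fun r =>
    (((da₁ r).pow 2).add ((db₁ r).pow 2)).congr_deriv (by simp)
  have dZ₀ : ∀ r, HasDerivAt Z₀ ((M' r + (2 * a₀ r * a₀' r + 2 * b₀ r * b₀' r)
      - (2 * a₁ r * a₁' r + 2 * b₁ r * b₁' r)) / 2) r := fun r =>
    (((dM r).add (hX₀ r)).sub (hX₁ r)).div_const 2
  have dZ₁ : ∀ r, HasDerivAt Z₁ ((M' r - (2 * a₀ r * a₀' r + 2 * b₀ r * b₀' r)
      + (2 * a₁ r * a₁' r + 2 * b₁ r * b₁' r)) / 2) r := fun r =>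
    (((dM r).sub (hX₀ r)).add (hX₁ r)).div_const 2
  set ρ₀ : ℝ → ℝ := fun r => ψ₀' r / ψ₀ r with hρ₀
  set ρ₁ : ℝ → ℝ := fun r => ψ₁' r / ψ₁ r with hρ₁
  set B : ℝ → ℝ := fun r => r * ρ₀ r * Z₀ r + r * ρ₁ r * Z₁ r with hB
  set S : ℝ → ℝ := fun r => r * ((a₀' r - ρ₀ r * a₀ r) ^ 2 + (b₀' r - ρ₀ r * b₀ r) ^ 2
        + (a₁' r - ρ₁ r * a₁ r) ^ 2 + (b₁' r - ρ₁ r * b₁ r) ^ 2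
        + (M r - a₀ r ^ 2 - b₀ r ^ 2 - a₁ r ^ 2 - b₁ r ^ 2) / 2 / r ^ 2) with hS
  have hSnonneg : ∀ r ∈ Ioc 0 R₁, 0 ≤ S r := by
    intro r hr
    have h1 := hbessel r
    have h2 : 0 ≤ (M r - a₀ r ^ 2 - b₀ r ^ 2 - a₁ r ^ 2 - b₁ r ^ 2) / 2 / r ^ 2 :=
      div_nonneg (by linarith) (by positivity)
    exact mul_nonneg hr.1.le (by positivity)
  have hBd : ∀ r ∈ Ioc 0 R₁, ∃ B', HasDerivAt B B' r ∧ B' + S r ≤ E r := by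
    intro r hr
    have p0 := pos₀ r hr
    have p1 := pos₁ r hr
    have s0 := hasDerivAt_logDeriv (W := V r - κ r * (ψ₁ r / ψ₀ r)) hr.1 p0.ne' (d₀ r hr)
      (dd₀ r hr) (by rw [ode₀ r hr]; field_simp)
    have s1 := hasDerivAt_logDeriv (W := V r + 1 / r ^ 2 - κ r / (ψ₁ r / ψ₀ r)) hr.1 p1.ne'
      (d₁ r hr) (dd₁ r hr) (by rw [ode₁ r hr]; have := hr.1.ne'; field_simp; ring)
    refine ⟨_, (s0.mul (dZ₀ r)).add (s1.mul (dZ₁ r)), ?_⟩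
    have hC : M r - a₀ r ^ 2 - b₀ r ^ 2 ≤ circAvg fun θ => pt r θ ^ 2 + qt r θ ^ 2 := by
      have w1 := circAvg_sq_sub_sq_circAvg_le (hp.deriv_t r) (hp.cont_t_slice r) (hp.periodic r)
      have w2 := circAvg_sq_sub_sq_circAvg_le (hq.deriv_t r) (hq.cont_t_slice r) (hq.periodic r)
      have := hp.cont_slice r
      have := hq.cont_slice r
      have := hp.cont_t_slice r
      have := hq.cont_t_slice r
      simp only [hM]
      rw [circAvg_add (by fun_prop) (by fun_prop), circAvg_add (by fun_prop) (by fun_prop)]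
      linarith
    exact flux_deriv_add_le hr.1 (hκ r hr) (div_pos p1 p0)
      (modes_sub_sq_le hk _ (hp.cont_slice r) (hq.cont_slice r) (hp.cont_r_slice r)
        (hq.cont_r_slice r)) (hbessel r) (modeSq_sub_le hk (hp.cont_slice r) (hq.cont_slice r)) hC
  have hEc : ContinuousOn E (Ioo 0 R₁) := by
    have c1 : Continuous fun r => circAvg (fun θ => pr r θ ^ 2 + qr r θ ^ 2) :=
      continuous_circAvg (f := fun r θ => pr r θ ^ 2 + qr r θ ^ 2) (by fun_prop)
    have c2 : Continuous fun r => circAvg (fun θ => pt r θ ^ 2 + qt r θ ^ 2) :=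
      continuous_circAvg (f := fun r θ => pt r θ ^ 2 + qt r θ ^ 2) (by fun_prop)
    have c3 : Continuous fun r => circAvg (fun θ => p r θ ^ 2 + q r θ ^ 2) :=
      continuous_circAvg (f := fun r θ => p r θ ^ 2 + q r θ ^ 2) (by fun_prop)
    have c4 : Continuous fun r => modeSq k (p r) (q r) :=
      continuous_circAvg (f := fun r θ => cos θ * (p r θ ^ 2 - q r θ ^ 2)
        + 2 * k * (sin θ * (p r θ * q r θ))) (by fun_prop)
    have c5 : ContinuousOn (fun r => circAvg (fun θ => pt r θ ^ 2 + qt r θ ^ 2) / r)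
        (Ioo 0 R₁) := c2.continuousOn.div continuousOn_id fun r hr => hr.1.ne'
    exact (((continuousOn_id.mul c1.continuousOn).add c5).add
      ((continuousOn_id.mul hVc).mul c3.continuousOn)).sub
      ((continuousOn_id.mul hκc).mul c4.continuousOn)
  set J : ℝ → ℝ := fun r => ∫ x in (0 : ℝ)..r, E x with hJ
  have hJd : ∀ r ∈ Ioo 0 R₁, HasDerivAt J (E r) r := by
    intro r hr
    refine intervalIntegral.integral_hasDerivAt_right
      (hint.mono_set ?_) ?_ (hEc.continuousAt (isOpen_Ioo.mem_nhds hr))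
    · rw [uIcc_of_le hr.1.le, uIcc_of_le hR₁.le]; exact Icc_subset_Icc_right hr.2.le
    · exact hEc.stronglyMeasurableAtFilter isOpen_Ioo r hr
  have hJc : ContinuousOn J (Icc 0 R₁) := by
    have := intervalIntegral.continuousOn_primitive_interval' hint left_mem_uIcc
    rwa [uIcc_of_le hR₁.le] at this
  have hBc : ContinuousOn B (Ioc 0 R₁) := fun r hr => by
    obtain ⟨B', h, -⟩ := hBd r hr
    exact h.continuousAt.continuousWithinAt
  have hmono : MonotoneOn (fun r => J r - B r) (Ioc 0 R₁) := by
    refine monotoneOn_of_deriv_nonneg (convex_Ioc 0 R₁)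
      ((hJc.mono Ioc_subset_Icc_self).sub hBc) ?_ ?_
    · intro r hr
      rw [interior_Ioc] at hr
      obtain ⟨B', h, -⟩ := hBd r (Ioo_subset_Ioc_self hr)
      exact ((hJd r hr).sub h).differentiableAt.differentiableWithinAt
    · intro r hr
      rw [interior_Ioc] at hr
      obtain ⟨B', h, hle⟩ := hBd r (Ioo_subset_Ioc_self hr)
      have e := ((hJd r hr).sub h).deriv
      have := hSnonneg r (Ioo_subset_Ioc_self hr)
      change 0 ≤ deriv (J - B) r
      rw [e]; linarith
  have hR₁m : R₁ ∈ Ioc 0 R₁ := ⟨hR₁, le_rfl⟩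
  have hpz : p R₁ = fun _ => 0 := funext hp0
  have hqz : q R₁ = fun _ => 0 := funext hq0
  have hend : M R₁ = 0 ∧ a₀ R₁ = 0 ∧ b₀ R₁ = 0 ∧ a₁ R₁ = 0 ∧ b₁ R₁ = 0 := by
    simp [hM, ha₀, hb₀, ha₁, hb₁, modeRe, modeIm, hpz, hqz, circAvg_const]
  have hBend : B R₁ = 0 := by
    obtain ⟨h1, h2, h3, h4, h5⟩ := hend
    simp [hB, hZ₀, hZ₁, h1, h2, h3, h4, h5]
  have hBle : ∀ r ∈ Ioc 0 δ, B r ≤ √D * r * Z₀ r + √(1 + D * δ ^ 2) * Z₁ r := by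
    intro r hr
    have hrR : Ioc 0 r ⊆ Ioc 0 R₁ := Ioc_subset_Ioc_right (hr.2.trans hδR)
    have hrm : r ∈ Ioc 0 r := ⟨hr.1, le_rfl⟩
    have g0 : r * ψ₀' r ≤ √D * r * ψ₀ r := by
      refine mul_deriv_le_of_euler_le (ψ'' := ψ₀'') hr.1 (mul_nonneg (sqrt_nonneg _) hr.1.le)
        (fun x hx => pos₀ x (hrR hx)) (fun x hx => d₀ x (hrR hx)) (fun x hx => dd₀ x (hrR hx)) ?_
      intro x hx
      rw [ode₀ x (hrR hx), mul_pow, sq_sqrt hD]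
      have h1 := hV x ⟨hx.1, hx.2.trans hr.2⟩
      have h2 := pos₀ x (hrR hx)
      have h3 := mul_nonneg (hκ x (hrR hx)) (pos₁ x (hrR hx)).le
      have h4 : x ^ 2 ≤ r ^ 2 := pow_le_pow_left₀ hx.1.le hx.2 2
      calc x ^ 2 * (V x * ψ₀ x - κ x * ψ₁ x) ≤ x ^ 2 * (D * ψ₀ x) := by
            refine mul_le_mul_of_nonneg_left ?_ (by positivity)
            nlinarith
        _ ≤ r ^ 2 * (D * ψ₀ x) := mul_le_mul_of_nonneg_right h4 (by positivity)
        _ = D * r ^ 2 * ψ₀ x := by ring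
    have g1 : r * ψ₁' r ≤ √(1 + D * δ ^ 2) * ψ₁ r := by
      refine mul_deriv_le_of_euler_le (ψ'' := ψ₁'') hr.1 (by positivity)
        (fun x hx => pos₁ x (hrR hx)) (fun x hx => d₁ x (hrR hx)) (fun x hx => dd₁ x (hrR hx)) ?_
      intro x hx
      rw [ode₁ x (hrR hx), sq_sqrt (by positivity)]
      have h1 := hV x ⟨hx.1, hx.2.trans hr.2⟩
      have h2 := pos₁ x (hrR hx)
      have h3 := mul_nonneg (hκ x (hrR hx)) (pos₀ x (hrR hx)).le
      have h4 : x ^ 2 ≤ δ ^ 2 := pow_le_pow_left₀ hx.1.le (hx.2.trans hr.2) 2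
      calc ψ₁ x + x ^ 2 * (V x * ψ₁ x - κ x * ψ₀ x) ≤ ψ₁ x + x ^ 2 * (D * ψ₁ x) := by
            refine add_le_add le_rfl (mul_le_mul_of_nonneg_left ?_ (by positivity))
            nlinarith
        _ ≤ ψ₁ x + δ ^ 2 * (D * ψ₁ x) :=
            add_le_add le_rfl (mul_le_mul_of_nonneg_right h4 (by positivity))
        _ = (1 + D * δ ^ 2) * ψ₁ x := by ring
    have p0 := pos₀ r (hrR hrm)
    have p1 := pos₁ r (hrR hrm)
    have k0 : r * ρ₀ r ≤ √D * r := by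
      simp only [hρ₀]; rw [← mul_div_assoc]; exact (div_le_iff₀ p0).2 g0
    have k1 : r * ρ₁ r ≤ √(1 + D * δ ^ 2) := by
      simp only [hρ₁]; rw [← mul_div_assoc]; exact (div_le_iff₀ p1).2 g1
    exact add_le_add (mul_le_mul_of_nonneg_right k0 (hZ₀0 r))
      (mul_le_mul_of_nonneg_right k1 (hZ₁0 r))
  have hZ₁zero : Z₁ 0 = 0 := by
    have e1 : p 0 = fun _ => p 0 0 := funext hp.center
    have e2 : q 0 = fun _ => q 0 0 := funext hq.center
    have f1 : M 0 = p 0 0 ^ 2 + q 0 0 ^ 2 := by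
      simp only [hM]; rw [e1, e2]; exact circAvg_const _
    have f2 : a₀ 0 = p 0 0 := by simp only [ha₀]; rw [e1]; exact circAvg_const _
    have f3 : b₀ 0 = q 0 0 := by simp only [hb₀]; rw [e2]; exact circAvg_const _
    have := hbessel 0
    have h1 : a₁ 0 ^ 2 + b₁ 0 ^ 2 = 0 := by
      rw [f1, f2, f3] at this
      nlinarith [sq_nonneg (a₁ 0), sq_nonneg (b₁ 0)]
    simp only [hZ₁, h1, f1, f2, f3]; ring
  have hlow : ∀ r ∈ Ioc 0 R₁, 0 ≤ J r - B r := by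
    intro r hr
    have hlim : Tendsto (fun x => J x - (√D * x * Z₀ x + √(1 + D * δ ^ 2) * Z₁ x))
        (𝓝[>] 0) (𝓝 0) := by
      have c0 : Continuous Z₀ := continuous_iff_continuousAt.2 fun r => (dZ₀ r).continuousAt
      have c1 : Continuous Z₁ := continuous_iff_continuousAt.2 fun r => (dZ₁ r).continuousAt
      have t1 : Tendsto (fun x => √D * x * Z₀ x + √(1 + D * δ ^ 2) * Z₁ x) (𝓝[>] 0) (𝓝 0) := by
        have c : Continuous fun x => √D * x * Z₀ x + √(1 + D * δ ^ 2) * Z₁ x := by fun_prop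
        have := c.tendsto 0
        rw [hZ₁zero] at this
        simpa using this.mono_left nhdsWithin_le_nhds
      have t2 : Tendsto J (𝓝[>] 0) (𝓝 0) := by
        have := hJc 0 ⟨le_rfl, hR₁.le⟩
        have h2 : Tendsto J (𝓝[Icc 0 R₁] 0) (𝓝 0) := by
          simpa [ContinuousWithinAt, hJ] using this
        refine h2.mono_left ?_
        rw [← nhdsWithin_Ioc_eq_nhdsGT hR₁]
        exact nhdsWithin_mono _ Ioc_subset_Icc_self
      simpa using t2.sub t1
    refine le_of_tendsto hlim ?_
    have hmem : Ioc 0 (min r δ) ∈ 𝓝[>] (0 : ℝ) := Ioc_mem_nhdsGT (lt_min hr.1 hδ)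
    filter_upwards [hmem] with x hx
    have hxr : x ≤ r := hx.2.trans (min_le_left _ _)
    have h1 := hmono ⟨hx.1, hxr.trans hr.2⟩ hr hxr
    have h2 := hBle x ⟨hx.1, hx.2.trans (min_le_right _ _)⟩
    simp only at h1
    linarith
  by_contra hcon
  have hJB : ∀ r ∈ Ioc 0 R₁, J r - B r = 0 := by
    intro r hr
    refine le_antisymm ?_ (hlow r hr)
    have h1 := hmono hr hR₁m hr.2
    simp only [hBend, sub_zero] at h1
    exact h1.trans (not_lt.1 hcon)
  have hS0 : ∀ r ∈ Ioo 0 R₁, S r = 0 := by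
    intro r hr
    obtain ⟨B', h, hle⟩ := hBd r (Ioo_subset_Ioc_self hr)
    have e1 : HasDerivAt (fun r => J r - B r) (E r - B') r := (hJd r hr).sub h
    have e2 : HasDerivAt (fun r => J r - B r) 0 r := by
      refine (hasDerivAt_const r (0 : ℝ)).congr_of_eventuallyEq ?_
      filter_upwards [isOpen_Ioo.mem_nhds hr] with x hx using hJB x (Ioo_subset_Ioc_self hx)
    have := e1.unique e2
    have := hSnonneg r (Ioo_subset_Ioc_self hr)
    linarith
  have hzero : ∀ r ∈ Ioo 0 R₁, a₀' r - ρ₀ r * a₀ r = 0 ∧ b₀' r - ρ₀ r * b₀ r = 0 ∧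
      a₁' r - ρ₁ r * a₁ r = 0 ∧ b₁' r - ρ₁ r * b₁ r = 0 ∧
      M r = a₀ r ^ 2 + b₀ r ^ 2 + a₁ r ^ 2 + b₁ r ^ 2 := by
    intro r hr
    have h0 := hS0 r hr
    simp only [hS] at h0
    have h0 := (mul_eq_zero.1 h0).resolve_left hr.1.ne'
    have h1 := hbessel r
    have h2 : 0 ≤ (M r - a₀ r ^ 2 - b₀ r ^ 2 - a₁ r ^ 2 - b₁ r ^ 2) / 2 / r ^ 2 :=
      div_nonneg (by linarith) (by positivity)
    have q1 := sq_nonneg (a₀' r - ρ₀ r * a₀ r)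
    have q2 := sq_nonneg (b₀' r - ρ₀ r * b₀ r)
    have q3 := sq_nonneg (a₁' r - ρ₁ r * a₁ r)
    have q4 := sq_nonneg (b₁' r - ρ₁ r * b₁ r)
    have h3 : (M r - a₀ r ^ 2 - b₀ r ^ 2 - a₁ r ^ 2 - b₁ r ^ 2) / 2 / r ^ 2 = 0 := by linarith
    refine ⟨pow_eq_zero_iff two_ne_zero |>.1 (by linarith),
      pow_eq_zero_iff two_ne_zero |>.1 (by linarith),
      pow_eq_zero_iff two_ne_zero |>.1 (by linarith),
      pow_eq_zero_iff two_ne_zero |>.1 (by linarith), ?_⟩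
    have h4 := (div_eq_zero_iff.1 h3).resolve_right (pow_ne_zero 2 hr.1.ne')
    linarith
  have hvanish : ∀ (ψ ψ' a a' : ℝ → ℝ), (∀ r ∈ Ioc 0 R₁, 0 < ψ r) →
      (∀ r ∈ Ioc 0 R₁, HasDerivAt ψ (ψ' r) r) → (∀ r, HasDerivAt a (a' r) r) →
      (∀ r ∈ Ioo 0 R₁, a' r - ψ' r / ψ r * a r = 0) → a R₁ = 0 → ∀ r ∈ Ioo 0 R₁, a r = 0 := by
    intro ψ ψ' a a' hpos hdψ hda hz hR r hr
    have hd : ∀ x ∈ Ioc 0 R₁, HasDerivAt (fun x => a x / ψ x)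
        ((a' x * ψ x - a x * ψ' x) / ψ x ^ 2) x := fun x hx =>
      (hda x).div (hdψ x hx) (hpos x hx).ne'
    have hc : a R₁ / ψ R₁ = a r / ψ r := by
      refine constant_of_has_deriv_right_zero (f := fun x => a x / ψ x) (a := r) (b := R₁)
        (fun x hx => (hd x ⟨hr.1.trans_le hx.1, hx.2⟩).continuousAt.continuousWithinAt) ?_ R₁
        ⟨hr.2.le, le_rfl⟩
      intro x hx
      have hx' : x ∈ Ioo 0 R₁ := ⟨hr.1.trans_le hx.1, hx.2⟩
      have hpx := (hpos x (Ioo_subset_Ioc_self hx')).ne'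
      have e : (a' x * ψ x - a x * ψ' x) / ψ x ^ 2 = 0 := by
        have := hz x hx'
        have : a' x * ψ x - a x * ψ' x = 0 := by
          field_simp at this
          linarith
        rw [this, zero_div]
      exact e ▸ (hd x (Ioo_subset_Ioc_self hx')).hasDerivWithinAt
    rw [hR, zero_div] at hc
    exact ((div_eq_zero_iff.1 hc.symm).resolve_right (hpos r (Ioo_subset_Ioc_self hr)).ne')
  obtain ⟨r, hr, hMr⟩ := hne
  obtain ⟨-, h2, h3, h4, h5⟩ := hend
  have z0 := hvanish ψ₀ ψ₀' a₀ a₀' pos₀ d₀ da₀ (fun r hr => (hzero r hr).1) h2 r hr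
  have z1 := hvanish ψ₀ ψ₀' b₀ b₀' pos₀ d₀ db₀ (fun r hr => (hzero r hr).2.1) h3 r hr
  have z2 := hvanish ψ₁ ψ₁' a₁ a₁' pos₁ d₁ da₁ (fun r hr => (hzero r hr).2.2.1) h4 r hr
  have z3 := hvanish ψ₁ ψ₁' b₁ b₁' pos₁ d₁ db₁ (fun r hr => (hzero r hr).2.2.2.1) h5 r hr
  have := (hzero r hr).2.2.2.2
  rw [z0, z1, z2, z3] at this
  simp only [hM] at this
  linarith

/-- The point of the plane with polar coordinates `(r, θ)`. -/
def polarPt (r θ : ℝ) : EuclideanSpace ℝ (Fin 2) := !₂[r * cos θ, r * sin θ]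

theorem continuous_polarPt : Continuous fun y : ℝ × ℝ => polarPt y.1 y.2 := by
  unfold polarPt
  refine (PiLp.continuous_toLp 2 _).comp (continuous_pi fun i => ?_)
  fin_cases i <;> simp <;> fun_prop

theorem norm_polarPt (r θ : ℝ) : ‖polarPt r θ‖ = |r| := by
  rw [EuclideanSpace.norm_eq, Fin.sum_univ_two, ← Real.sqrt_sq_eq_abs]
  congr 1
  simp only [polarPt, norm_eq_abs, sq_abs, PiLp.toLp_apply, Matrix.cons_val_zero,
    Matrix.cons_val_one]
  linear_combination r ^ 2 * sin_sq_add_cos_sq θ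

theorem exists_polarPt_eq (x : EuclideanSpace ℝ (Fin 2)) :
    ∃ θ ∈ Ioc (-π) π, polarPt ‖x‖ θ = x := by
  refine ⟨Complex.arg ⟨x 0, x 1⟩, Complex.arg_mem_Ioc _, ?_⟩
  have hn : ‖x‖ = ‖(⟨x 0, x 1⟩ : ℂ)‖ := by
    rw [EuclideanSpace.norm_eq, Complex.norm_def, Complex.normSq_mk, Fin.sum_univ_two]
    simp only [norm_eq_abs, sq_abs, ← sq]
  ext i
  fin_cases i
  · simp [polarPt, hn]
  · simp [polarPt, hn]

theorem hasDerivAt_polarPt_radial (r θ : ℝ) :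
    HasDerivAt (fun r => polarPt r θ) !₂[cos θ, sin θ] r := by
  rw [hasDerivAt_iff_hasFDerivAt, ← hasFDerivWithinAt_univ, hasFDerivWithinAt_euclidean]
  intro i
  rw [hasFDerivWithinAt_univ, hasFDerivAt_iff_hasDerivAt]
  fin_cases i
  · simpa [polarPt] using (hasDerivAt_id r).mul_const (cos θ)
  · simpa [polarPt] using (hasDerivAt_id r).mul_const (sin θ)

theorem hasDerivAt_polarPt_angular (r θ : ℝ) :
    HasDerivAt (fun θ => polarPt r θ) !₂[r * -sin θ, r * cos θ] θ := by
  rw [hasDerivAt_iff_hasFDerivAt, ← hasFDerivWithinAt_univ, hasFDerivWithinAt_euclidean]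
  intro i
  rw [hasFDerivWithinAt_univ, hasFDerivAt_iff_hasDerivAt]
  fin_cases i
  · simpa [polarPt] using (hasDerivAt_cos θ).const_mul r
  · simpa [polarPt] using (hasDerivAt_sin θ).const_mul r

/-- The partial derivative of `g` in the direction of the `α`-th coordinate. -/
def partialDeriv (g : EuclideanSpace ℝ (Fin 2) → ℝ) (α : Fin 2)
    (x : EuclideanSpace ℝ (Fin 2)) : ℝ := fderiv ℝ g x (EuclideanSpace.single α 1)

theorem fderiv_apply_vec (g : EuclideanSpace ℝ (Fin 2) → ℝ) (x : EuclideanSpace ℝ (Fin 2))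
    (s t : ℝ) : fderiv ℝ g x !₂[s, t] = s * partialDeriv g 0 x + t * partialDeriv g 1 x := by
  have : (!₂[s, t] : EuclideanSpace ℝ (Fin 2)) =
      s • EuclideanSpace.single 0 1 + t • EuclideanSpace.single 1 1 := by
    ext i; fin_cases i <;> simp
  rw [this, map_add, map_smul, map_smul]
  rfl

theorem continuous_partialDeriv {g : EuclideanSpace ℝ (Fin 2) → ℝ} (hg : ContDiff ℝ 1 g)
    (α : Fin 2) : Continuous (partialDeriv g α) :=
  (hg.continuous_fderiv one_ne_zero).clm_apply continuous_const

/-- The radial derivative of `g` at the point with polar coordinates `(r, θ)`. -/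
def radialDeriv (g : EuclideanSpace ℝ (Fin 2) → ℝ) (r θ : ℝ) : ℝ :=
  cos θ * partialDeriv g 0 (polarPt r θ) + sin θ * partialDeriv g 1 (polarPt r θ)

/-- The derivative of `g` with respect to the angle at the point with polar coordinates
`(r, θ)`. -/
def angularDeriv (g : EuclideanSpace ℝ (Fin 2) → ℝ) (r θ : ℝ) : ℝ :=
  r * -sin θ * partialDeriv g 0 (polarPt r θ) + r * cos θ * partialDeriv g 1 (polarPt r θ)

theorem polarField_of_contDiff {g : EuclideanSpace ℝ (Fin 2) → ℝ} (hg : ContDiff ℝ 1 g) :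
    PolarField (fun r θ => g (polarPt r θ)) (radialDeriv g) (angularDeriv g) := by
  have hd : ∀ x, HasFDerivAt g (fderiv ℝ g x) x := fun x =>
    (hg.differentiable one_ne_zero x).hasFDerivAt
  have c := continuous_polarPt
  have c0 := (continuous_partialDeriv hg 0).comp c
  have c1 := (continuous_partialDeriv hg 1).comp c
  simp only [Function.comp_def] at c0 c1
  refine ⟨hg.continuous.comp c, ?_, ?_, fun r θ => ?_, fun r θ => ?_, fun r => ?_, fun θ => ?_⟩
  · unfold radialDeriv; fun_prop
  · unfold angularDeriv; fun_prop
  · rw [radialDeriv, ← fderiv_apply_vec]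
    exact (hd _).comp_hasDerivAt r (hasDerivAt_polarPt_radial r θ)
  · rw [angularDeriv, ← fderiv_apply_vec]
    exact (hd _).comp_hasDerivAt θ (hasDerivAt_polarPt_angular r θ)
  · simp [polarPt]
  · simp [polarPt]

theorem radialDeriv_sq_add (g : EuclideanSpace ℝ (Fin 2) → ℝ) {r : ℝ} (hr : r ≠ 0) (θ : ℝ) :
    radialDeriv g r θ ^ 2 + angularDeriv g r θ ^ 2 / r ^ 2 =
      partialDeriv g 0 (polarPt r θ) ^ 2 + partialDeriv g 1 (polarPt r θ) ^ 2 := by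
  rw [radialDeriv, angularDeriv]
  field_simp
  linear_combination (partialDeriv g 0 (polarPt r θ) ^ 2 + partialDeriv g 1 (polarPt r θ) ^ 2) *
    sin_sq_add_cos_sq θ

theorem integral_eq_setIntegral_polarPt (f : EuclideanSpace ℝ (Fin 2) → ℝ) :
    ∫ x, f x = ∫ y in Ioi (0 : ℝ) ×ˢ Ioo (-π) π, y.1 * f (polarPt y.1 y.2) := by
  have h1 := (PiLp.volume_preserving_toLp (Fin 2)).integral_comp
    (MeasurableEquiv.toLp 2 (Fin 2 → ℝ)).measurableEmbedding f
  have h2 := (volume_preserving_finTwoArrow ℝ).symm.integral_comp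
    (MeasurableEquiv.finTwoArrow (α := ℝ)).symm.measurableEmbedding
    (fun y => f (WithLp.toLp 2 y))
  rw [← h1, ← h2, ← integral_comp_polarCoord_symm]
  refine setIntegral_congr_fun polarCoord.open_target.measurableSet fun y hy => ?_
  simp only [smul_eq_mul, polarCoord_symm_apply]
  rfl

/-- Integration in polar coordinates of a function vanishing outside a disk. -/
theorem integral_eq_intervalIntegral_polar {f : EuclideanSpace ℝ (Fin 2) → ℝ} {F : ℝ → ℝ → ℝ}
    {R₁ : ℝ} (hR₁ : 0 ≤ R₁) (hF : ∀ r ∈ Ioo 0 R₁, ∀ θ, r * f (polarPt r θ) = F r θ)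
    (hf : ∀ x, R₁ ≤ ‖x‖ → f x = 0)
    (hint : IntegrableOn (fun y : ℝ × ℝ => F y.1 y.2) (Ioo 0 R₁ ×ˢ Ioo (-π) π)) :
    IntervalIntegrable (fun r => circAvg (F r)) volume 0 R₁ ∧
      ∫ x, f x = 2 * π * ∫ r in (0 : ℝ)..R₁, circAvg (F r) := by
  have hpi : -π ≤ π := by linarith [pi_pos]
  have hc : ∀ r, circAvg (F r) = (2 * π)⁻¹ * ∫ θ in Ioo (-π) π, F r θ := fun r => by
    rw [circAvg, intervalIntegral.integral_of_le hpi, integral_Ioc_eq_integral_Ioo]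
  have hint' := hint
  rw [IntegrableOn, Measure.volume_eq_prod, ← Measure.prod_restrict] at hint'
  constructor
  · rw [intervalIntegrable_iff_integrableOn_Ioo_of_le hR₁]
    simp only [hc]
    exact (hint'.integral_prod_left).const_mul _
  rw [integral_eq_setIntegral_polarPt, intervalIntegral.integral_of_le hR₁,
    integral_Ioc_eq_integral_Ioo]
  simp only [hc]
  rw [integral_const_mul, ← mul_assoc, mul_inv_cancel₀ (by positivity), one_mul]
  rw [← setIntegral_prod (fun y : ℝ × ℝ => F y.1 y.2) (by rwa [Measure.volume_eq_prod] at hint)]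
  rw [← Measure.volume_eq_prod]
  have hsub : Ioo 0 R₁ ×ˢ Ioo (-π) π ⊆ Ioi (0 : ℝ) ×ˢ Ioo (-π) π :=
    prod_mono Ioo_subset_Ioi_self subset_rfl
  rw [setIntegral_eq_of_subset_of_forall_sdiff_eq_zero
    (measurableSet_Ioi.prod measurableSet_Ioo) hsub]
  · exact setIntegral_congr_fun (measurableSet_Ioo.prod measurableSet_Ioo)
      fun y hy => hF y.1 hy.1 y.2
  · intro y hy
    have : R₁ ≤ y.1 := by
      by_contra h
      exact hy.2 ⟨⟨hy.1.1, not_le.1 h⟩, hy.1.2⟩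
    rw [hf _ (by rw [norm_polarPt]; exact this.trans (le_abs_self _)), mul_zero]

theorem integrableOn_mul_of_bounded {W : ℝ → ℝ} {B : ℝ → ℝ → ℝ} {R₁ D : ℝ}
    (hW : ContinuousOn W (Ioo 0 R₁)) (hD : ∀ r ∈ Ioo 0 R₁, |W r| ≤ D)
    (hB : Continuous fun y : ℝ × ℝ => B y.1 y.2) :
    IntegrableOn (fun y : ℝ × ℝ => W y.1 * B y.1 y.2) (Ioo 0 R₁ ×ˢ Ioo (-π) π) := by
  have hms : MeasurableSet (Ioo 0 R₁ ×ˢ Ioo (-π) π) := measurableSet_Ioo.prod measurableSet_Ioo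
  have hBi : IntegrableOn (fun y : ℝ × ℝ => B y.1 y.2) (Ioo 0 R₁ ×ˢ Ioo (-π) π) :=
    (hB.continuousOn.integrableOn_compact (isCompact_Icc.prod isCompact_Icc)).mono_set
      (prod_mono Ioo_subset_Icc_self Ioo_subset_Icc_self)
  refine hBi.bdd_mul (c := D) ?_ ?_
  · exact (hW.comp continuousOn_fst fun y hy => hy.1).aestronglyMeasurable hms
  · filter_upwards [ae_restrict_mem hms] with y hy using hD _ hy.1

theorem Qmap_polarPt (k : ℤ) (u v : ℝ → ℝ) {r : ℝ} (hr : 0 < r) (θ : ℝ) :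
    Qmap k u v (polarPt r θ) =
      !![u r / √2 * cos θ - v r / √6, u r / √2 * (k * sin θ), 0;
        u r / √2 * (k * sin θ), -(u r / √2 * cos θ) - v r / √6, 0;
        0, 0, 2 * (v r / √6)] := by
  have h0 : polarPt r θ ≠ 0 := by
    rw [← norm_pos_iff, norm_polarPt]; exact abs_pos.2 hr.ne'
  have h6 : √(3 / 2) = 3 / √6 := by
    rw [show (3 : ℝ) / 2 = 3 ^ 2 / 6 by norm_num, Real.sqrt_div (by norm_num),
      Real.sqrt_sq (by norm_num)]
  have hs : u r / (√2 * r) * r = u r / √2 := by field_simp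
  rw [Qmap, if_neg h0, norm_polarPt, abs_of_pos hr, h6]
  ext i j
  fin_cases i <;> fin_cases j <;> simp [Mk, E0base, polarPt, ← hs] <;> ring

theorem trace_mul_self_of_offDiag {A : Matrix (Fin 3) (Fin 3) ℝ} {p q : ℝ}
    (hA : A = !![0, 0, p; 0, 0, q; p, q, 0]) :
    (A * A).trace = 2 * (p ^ 2 + q ^ 2) ∧
    ∀ c d e f, (A * A * !![c, d, 0; d, e, 0; 0, 0, f]).trace =
      c * p ^ 2 + 2 * d * (p * q) + e * q ^ 2 + f * (p ^ 2 + q ^ 2) ∧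
    (!![c, d, 0; d, e, 0; 0, 0, f] * A).trace = 0 := by
  subst hA
  simp only [Matrix.trace, Matrix.diag, Matrix.mul_apply, Fin.sum_univ_three]
  simp
  constructor <;> intros <;> ring

theorem gradSq_of_offDiag {P : EuclideanSpace ℝ (Fin 2) → Matrix (Fin 3) (Fin 3) ℝ}
    (hP : ∀ x, P x = !![0, 0, P x 0 2; 0, 0, P x 1 2; P x 0 2, P x 1 2, 0])
    (x : EuclideanSpace ℝ (Fin 2)) :
    gradSq P x = 2 * ((partialDeriv (fun y => P y 0 2) 0 x ^ 2
        + partialDeriv (fun y => P y 0 2) 1 x ^ 2)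
      + (partialDeriv (fun y => P y 1 2) 0 x ^ 2 + partialDeriv (fun y => P y 1 2) 1 x ^ 2)) := by
  have e (i j : Fin 3) : (fun y => P y i j) = fun y =>
      !![0, 0, P y 0 2; 0, 0, P y 1 2; P y 0 2, P y 1 2, 0] i j :=
    funext fun y => congrFun (congrFun (hP y) i) j
  have h00 : (fun y => P y 0 0) = fun _ => 0 := e 0 0
  have h01 : (fun y => P y 0 1) = fun _ => 0 := e 0 1
  have h10 : (fun y => P y 1 0) = fun _ => 0 := e 1 0
  have h11 : (fun y => P y 1 1) = fun _ => 0 := e 1 1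
  have h22 : (fun y => P y 2 2) = fun _ => 0 := e 2 2
  have h20 : (fun y => P y 2 0) = fun y => P y 0 2 := e 2 0
  have h21 : (fun y => P y 2 1) = fun y => P y 1 2 := e 2 1
  simp only [gradSq, Fin.sum_univ_two, Fin.sum_univ_three, h00, h01, h10, h11, h22, h20, h21,
    partialDeriv, fderiv_fun_const]
  simp only [Pi.zero_apply, zero_apply]
  ring

/-- The integrand of `Lform`. -/
def secondVariationDensity (a2 b2 c2 : ℝ)
    (Q P : EuclideanSpace ℝ (Fin 2) → Matrix (Fin 3) (Fin 3) ℝ)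
    (x : EuclideanSpace ℝ (Fin 2)) : ℝ :=
  gradSq P x - a2 * (P x * P x).trace - 2 * b2 * (P x * P x * Q x).trace
    + c2 * ((Q x * Q x).trace * (P x * P x).trace + 2 * ((Q x * P x).trace) ^ 2)

theorem secondVariationDensity_eq_zero {a2 b2 c2 : ℝ}
    {Q P : EuclideanSpace ℝ (Fin 2) → Matrix (Fin 3) (Fin 3) ℝ}
    {x : EuclideanSpace ℝ (Fin 2)} (hx : x ∉ tsupport P) :
    secondVariationDensity a2 b2 c2 Q P x = 0 := by
  have h0 : P x = 0 := image_eq_zero_of_notMem_tsupport hx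
  have h1 : gradSq P x = 0 := by
    refine Finset.sum_eq_zero fun α _ => Finset.sum_eq_zero fun i _ =>
      Finset.sum_eq_zero fun j _ => ?_
    have : (fun y => P y i j) =ᶠ[𝓝 x] fun _ => 0 := by
      filter_upwards [(isClosed_tsupport P).isOpen_compl.mem_nhds hx] with y hy
      rw [image_eq_zero_of_notMem_tsupport hy, Matrix.zero_apply]
    rw [this.fderiv_eq, fderiv_fun_const]
    simp
  simp [secondVariationDensity, h0, h1]

/-- The second variation density on matrix fields in `V₂` along the circle of radius `r`,
multiplied by the Jacobian of polar coordinates. -/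
theorem mul_secondVariationDensity_polarPt {a2 b2 c2 : ℝ} {k : ℤ} (hk : k = 1 ∨ k = -1)
    {u v : ℝ → ℝ} {P : EuclideanSpace ℝ (Fin 2) → Matrix (Fin 3) (Fin 3) ℝ}
    (hP : ∀ x, P x = !![0, 0, P x 0 2; 0, 0, P x 1 2; P x 0 2, P x 1 2, 0])
    {r : ℝ} (hr : 0 < r) (θ : ℝ) :
    r * secondVariationDensity a2 b2 c2 (Qmap k u v) P (polarPt r θ) =
      r * gradSq P (polarPt r θ)
      + (-a2 - b2 * (v r / √6) + c2 * (u r ^ 2 + v r ^ 2)) *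
        (2 * (r * (P (polarPt r θ) 0 2 ^ 2 + P (polarPt r θ) 1 2 ^ 2)))
      - b2 * (u r / √2) *
        (2 * (r * (cos θ * (P (polarPt r θ) 0 2 ^ 2 - P (polarPt r θ) 1 2 ^ 2)
          + 2 * k * (sin θ * (P (polarPt r θ) 0 2 * P (polarPt r θ) 1 2))))) := by
  obtain ⟨h1, h2⟩ := trace_mul_self_of_offDiag (hP (polarPt r θ))
  have hQ : (Qmap k u v (polarPt r θ) * Qmap k u v (polarPt r θ)).trace = u r ^ 2 + v r ^ 2 := by
    rw [Qmap_polarPt k u v hr]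
    simp only [Matrix.trace, Matrix.diag, Matrix.mul_apply, Fin.sum_univ_three]
    have hk2 : (k : ℝ) ^ 2 = 1 := by rcases hk with rfl | rfl <;> norm_num
    have hu : (u r / √2) ^ 2 = u r ^ 2 / 2 := by rw [div_pow, Real.sq_sqrt (by norm_num)]
    have hv : (v r / √6) ^ 2 = v r ^ 2 / 6 := by rw [div_pow, Real.sq_sqrt (by norm_num)]
    simp
    linear_combination 2 * (u r / √2) ^ 2 * sin_sq_add_cos_sq θ
      + 2 * (u r / √2) ^ 2 * sin θ ^ 2 * hk2 + 2 * hu + 6 * hv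
  have h3 := h2 (u r / √2 * cos θ - v r / √6) (u r / √2 * (k * sin θ))
    (-(u r / √2 * cos θ) - v r / √6) (2 * (v r / √6))
  rw [← Qmap_polarPt k u v hr] at h3
  rw [secondVariationDensity, h1, h3.1, h3.2, hQ]
  ring

theorem circAvg_density_eq {k : ℝ} {V κ : ℝ → ℝ} {p pr pt q qr qt : ℝ → ℝ → ℝ}
    (hp : PolarField p pr pt) (hq : PolarField q qr qt) (r : ℝ) :
    circAvg (fun θ => 2 * (r * (pr r θ ^ 2 + qr r θ ^ 2) + r⁻¹ * (pt r θ ^ 2 + qt r θ ^ 2)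
      + r * V r * (p r θ ^ 2 + q r θ ^ 2)
      - r * κ r * (cos θ * (p r θ ^ 2 - q r θ ^ 2) + 2 * k * (sin θ * (p r θ * q r θ))))) =
    2 * angularEnergy k V κ p pr pt q qr qt r := by
  have c1 := hp.cont_slice r
  have c2 := hp.cont_r_slice r
  have c3 := hp.cont_t_slice r
  have c4 := hq.cont_slice r
  have c5 := hq.cont_r_slice r
  have c6 := hq.cont_t_slice r
  rw [circAvg_const_mul, circAvg_sub (by fun_prop) (by fun_prop),
    circAvg_add (by fun_prop) (by fun_prop), circAvg_add (by fun_prop) (by fun_prop),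
    circAvg_const_mul, circAvg_const_mul, circAvg_const_mul, circAvg_const_mul, angularEnergy,
    modeSq]
  ring

theorem Ioc_subset_Iset {R : ℝ≥0∞} {R₁ : ℝ} (h : ENNReal.ofReal R₁ < R) :
    Ioc 0 R₁ ⊆ Iset R := fun _ hr =>
  ⟨hr.1, (ENNReal.ofReal_le_ofReal hr.2).trans_lt h⟩

theorem isOpen_Iset (R : ℝ≥0∞) : IsOpen (Iset R) :=
  isOpen_Ioi.inter (isOpen_Iio.preimage ENNReal.continuous_ofReal)

theorem exists_bound_of_bound_near_zero {f : ℝ → ℝ} {δ C R₁ : ℝ} (hδ : 0 < δ)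
    (hf : ContinuousOn f (Ioc 0 R₁)) (hC : ∀ r ∈ Ioc 0 δ, |f r| ≤ C) :
    ∃ C', ∀ r ∈ Ioc 0 R₁, |f r| ≤ C' := by
  obtain ⟨C₁, h₁⟩ := isCompact_Icc.exists_bound_of_continuousOn
    (hf.mono fun r (hr : r ∈ Icc δ R₁) => ⟨hδ.trans_le hr.1, hr.2⟩)
  refine ⟨max C C₁, fun r hr => ?_⟩
  rcases le_total r δ with h | h
  · exact (hC r ⟨hr.1, h⟩).trans (le_max_left _ _)
  · exact (h₁ r ⟨h, hr.2⟩).trans (le_max_right _ _)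

namespace ProfileSolution

variable {a2 b2 c2 : ℝ} {k : ℤ} {R : ℝ≥0∞} {u v : ℝ → ℝ}

theorem exists_bound_u (h : ProfileSolution a2 b2 c2 k R u v) {R₁ : ℝ}
    (hR₁ : ENNReal.ofReal R₁ < R) : ∃ C, ∀ r ∈ Ioc 0 R₁, |u r| ≤ C := by
  have h1 : ∀ᶠ r in 𝓝[>] (0 : ℝ), |u r| < 1 := by
    have := h.bc0_u.abs
    rw [abs_zero] at this
    exact this.eventually_lt_const one_pos
  obtain ⟨δ, hδ, h2⟩ := mem_nhdsGT_iff_exists_Ioc_subset.1 h1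
  exact exists_bound_of_bound_near_zero hδ
    (h.smooth_u.continuousOn.mono (Ioc_subset_Iset hR₁)) fun r hr => (h2 hr).le

theorem exists_bound_v (h : ProfileSolution a2 b2 c2 k R u v) {R₁ : ℝ} (hR₀ : 0 < R₁)
    (hR₁ : ENNReal.ofReal R₁ < R) : ∃ C, ∀ r ∈ Ioc 0 R₁, |v r| ≤ C := by
  have h1 : ∀ᶠ r in 𝓝[>] (0 : ℝ), |deriv v r| < 1 := by
    have := h.bc0_v.abs
    rw [abs_zero] at this
    exact this.eventually_lt_const one_pos
  obtain ⟨δ, hδ, h2⟩ := mem_nhdsGT_iff_exists_Ioc_subset.1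
    (inter_mem h1 (Ioc_mem_nhdsGT hR₀))
  have hδm : δ ∈ Ioc 0 δ := ⟨hδ, le_rfl⟩
  refine exists_bound_of_bound_near_zero (C := |v δ| + δ) hδ
    (h.smooth_v.continuousOn.mono (Ioc_subset_Iset hR₁)) fun r hr => ?_
  have h3 := (convex_Ioc 0 δ).norm_image_sub_le_of_norm_deriv_le (f := v) (C := 1)
    (fun x hx => ((h.smooth_v.differentiableOn two_ne_zero).differentiableAt
      ((isOpen_Iset R).mem_nhds (Ioc_subset_Iset hR₁ (h2 hx).2))))
    (fun x hx => (h2 hx).1.le) hδm hr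
  rw [norm_eq_abs, norm_eq_abs, one_mul, abs_sub_comm r δ, abs_of_nonneg (sub_nonneg.2 hr.2)] at h3
  have h4 := abs_sub_abs_le_abs_sub (v r) (v δ)
  linarith [hr.1]

end ProfileSolution

theorem hasDerivAt_of_contDiffOn_two {f : ℝ → ℝ} {s : Set ℝ} (hs : IsOpen s)
    (hf : ContDiffOn ℝ 2 f s) {r : ℝ} (hr : r ∈ s) :
    HasDerivAt f (deriv f r) r ∧ HasDerivAt (deriv f) (deriv (deriv f) r) r := by
  refine ⟨((hf.differentiableOn two_ne_zero).differentiableAt (hs.mem_nhds hr)).hasDerivAt, ?_⟩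
  have : ContDiffOn ℝ 1 (deriv f) s := by
    have h2 : ContDiffOn ℝ (1 + 1) f s := by rw [one_add_one_eq_two]; exact hf
    exact ((contDiffOn_succ_iff_deriv_of_isOpen hs).1 h2).2.2
  exact ((this.differentiableOn one_ne_zero).differentiableAt (hs.mem_nhds hr)).hasDerivAt

theorem exists_radius_of_tsupport_subset_ball2
    {P : EuclideanSpace ℝ (Fin 2) → Matrix (Fin 3) (Fin 3) ℝ} {R : ℝ≥0∞}
    (hPc : HasCompactSupport P) (hPs : tsupport P ⊆ ball2 R) (hPne : P ≠ 0) :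
    ∃ R₁ : ℝ, 0 < R₁ ∧ ENNReal.ofReal R₁ < R ∧ ∀ x, R₁ ≤ ‖x‖ → x ∉ tsupport P := by
  have hne : (tsupport P).Nonempty := by
    rw [nonempty_iff_ne_empty, Ne, tsupport_eq_empty_iff]; exact hPne
  obtain ⟨x₀, hx₀, hmax⟩ := hPc.isCompact.exists_isMaxOn hne continuous_norm.continuousOn
  obtain ⟨R₁, h0, h1, h2⟩ := ENNReal.lt_iff_exists_real_btwn.1 (hPs hx₀)
  have h3 : ‖x₀‖ < R₁ := (ENNReal.ofReal_lt_ofReal_iff'.1 h1).1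
  exact ⟨R₁, (norm_nonneg _).trans_lt h3, h2, fun x hx hxs => (h3.trans_le hx).not_ge (hmax hxs)⟩

theorem circAvg_pos {f : ℝ → ℝ} (hf : Continuous f) (h0 : ∀ θ, 0 ≤ f θ) {θ : ℝ}
    (hθ : θ ∈ Ioc (-π) π) (hpos : 0 < f θ) : 0 < circAvg f := by
  refine mul_pos (by positivity) ?_
  exact intervalIntegral.integral_pos (by linarith [pi_pos]) hf.continuousOn (fun x _ => h0 x)
    ⟨θ, Ioc_subset_Icc_self hθ, hpos⟩

/-- **Strict positivity on the subspace `V₂`**: for a profile solution with `u > 0`,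
`v < 0` and `k = ±1`, the second variation `L[Q](P)` is strictly positive for every nonzero
smooth compactly supported `P : B_R → S₀` all of whose entries vanish except possibly the
`(1,3)`, `(3,1)`, `(2,3)` and `(3,2)` ones. -/
theorem stmt7 (a2 b2 c2 : ℝ) (ha : 0 ≤ a2) (hb : 0 < b2) (hc : 0 < c2)
    (k : ℤ) (hk : k = 1 ∨ k = -1) (R : ℝ≥0∞) (hR : 0 < R)
    (u v : ℝ → ℝ) (hsol : ProfileSolution a2 b2 c2 k R u v)
    (hu : ∀ r ∈ Iset R, 0 < u r) (hv : ∀ r ∈ Iset R, v r < 0)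
    (P : EuclideanSpace ℝ (Fin 2) → Matrix (Fin 3) (Fin 3) ℝ)
    (hPsmooth : ∀ i j, ContDiff ℝ (⊤ : ℕ∞) fun x => P x i j)
    (hPc : HasCompactSupport P) (hPs : tsupport P ⊆ ball2 R)
    (hPsym : ∀ x, (P x).IsSymm) (hPtr : ∀ x, (P x).trace = 0)
    (hPzero : ∀ x (i j : Fin 3),
      ¬((i = 0 ∧ j = 2) ∨ (i = 2 ∧ j = 0) ∨ (i = 1 ∧ j = 2) ∨ (i = 2 ∧ j = 1)) →
      P x i j = 0)
    (hPne : P ≠ 0) :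
    0 < Lform a2 b2 c2 R (Qmap k u v) P := by
  obtain ⟨R₁, hR₀, hR₁, hout⟩ := exists_radius_of_tsupport_subset_ball2 hPc hPs hPne
  have hform : ∀ x, P x = !![0, 0, P x 0 2; 0, 0, P x 1 2; P x 0 2, P x 1 2, 0] := by
    intro x
    have h20 := (hPsym x).apply 0 2
    have h21 := (hPsym x).apply 1 2
    ext i j
    fin_cases i <;> fin_cases j <;>
      first | rfl | exact h20 | exact h21 | exact hPzero x _ _ (by decide)
  have hLf : Lform a2 b2 c2 R (Qmap k u v) P =
      ∫ x, secondVariationDensity a2 b2 c2 (Qmap k u v) P x :=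
    setIntegral_eq_integral_of_forall_compl_eq_zero fun x hx =>
      secondVariationDensity_eq_zero fun h => hx (hPs h)
  have hk2 : (k : ℝ) ^ 2 = 1 := by rcases hk with rfl | rfl <;> norm_num
  have hkR : (k : ℝ) = 1 ∨ (k : ℝ) = -1 := by rcases hk with rfl | rfl <;> norm_num
  have hsub := Ioc_subset_Iset hR₁
  have hsub' : Ioo 0 R₁ ⊆ Iset R := Ioo_subset_Ioc_self.trans hsub
  have hsmooth : ∀ i j, ContDiff ℝ 1 fun x => P x i j := fun i j =>
    (hPsmooth i j).of_le (by exact_mod_cast le_top)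
  have hp := polarField_of_contDiff (hsmooth 0 2)
  have hq := polarField_of_contDiff (hsmooth 1 2)
  set V : ℝ → ℝ := fun r => -a2 - b2 * (v r / √6) + c2 * (u r ^ 2 + v r ^ 2) with hVdef
  set κ : ℝ → ℝ := fun r => b2 * (u r / √2) with hκdef
  have cu := hsol.smooth_u.continuousOn
  have cv := hsol.smooth_v.continuousOn
  have hVc : ContinuousOn V (Ioo 0 R₁) := by
    have := cu.mono hsub'
    have := cv.mono hsub'
    fun_prop
  have hκc : ContinuousOn κ (Ioo 0 R₁) := by
    have := cu.mono hsub'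
    fun_prop
  obtain ⟨Cu, hCu⟩ := hsol.exists_bound_u hR₁
  obtain ⟨Cv, hCv⟩ := hsol.exists_bound_v hR₀ hR₁
  obtain ⟨Cκ, hCκ⟩ : ∃ C, ∀ r ∈ Ioo 0 R₁, |κ r| ≤ C := by
    refine ⟨b2 * (Cu / √2), fun r hr => ?_⟩
    have := hCu r (Ioo_subset_Ioc_self hr)
    rw [hκdef]
    simp only
    rw [abs_mul, abs_div, abs_of_pos hb, abs_of_nonneg (Real.sqrt_nonneg 2)]
    gcongr
  obtain ⟨D, hD0, hD⟩ : ∃ D, 0 ≤ D ∧ ∀ r ∈ Ioc 0 R₁, |V r| ≤ D := by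
    have h : ∀ r ∈ Ioc 0 R₁, |V r| ≤ a2 + b2 * (Cv / √6) + c2 * (Cu ^ 2 + Cv ^ 2) := by
      intro r hr
      have h1 := hCu r hr
      have h2 := hCv r hr
      have h3 : |b2 * (v r / √6)| ≤ b2 * (Cv / √6) := by
        rw [abs_mul, abs_div, abs_of_pos hb, abs_of_nonneg (Real.sqrt_nonneg 6)]
        gcongr
      have h4 : c2 * (u r ^ 2 + v r ^ 2) ≤ c2 * (Cu ^ 2 + Cv ^ 2) := by
        rw [← sq_abs (u r), ← sq_abs (v r)]
        gcongr
      have h5 : 0 ≤ c2 * (u r ^ 2 + v r ^ 2) := by positivity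
      have h6 := abs_le.1 h3
      rw [hVdef]
      exact abs_le.2 ⟨by linarith [h6.2], by linarith [h6.1]⟩
    exact ⟨_, (abs_nonneg _).trans (h R₁ ⟨hR₀, le_rfl⟩), h⟩
  have hvan : ∀ x, R₁ ≤ ‖x‖ → P x = 0 := fun x hx =>
    image_eq_zero_of_notMem_tsupport (hout x hx)
  have hF := integral_eq_intervalIntegral_polar (R₁ := R₁)
    (f := secondVariationDensity a2 b2 c2 (Qmap k u v) P)
    (F := fun r θ => 2 * (r * (radialDeriv (fun x => P x 0 2) r θ ^ 2
          + radialDeriv (fun x => P x 1 2) r θ ^ 2)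
        + r⁻¹ * (angularDeriv (fun x => P x 0 2) r θ ^ 2
          + angularDeriv (fun x => P x 1 2) r θ ^ 2)
        + r * V r * (P (polarPt r θ) 0 2 ^ 2 + P (polarPt r θ) 1 2 ^ 2)
        - r * κ r * (cos θ * (P (polarPt r θ) 0 2 ^ 2 - P (polarPt r θ) 1 2 ^ 2)
          + 2 * k * (sin θ * (P (polarPt r θ) 0 2 * P (polarPt r θ) 1 2)))))
    hR₀.le ?_ (fun x hx => secondVariationDensity_eq_zero (hout x hx)) ?_
  · obtain ⟨hint, heq⟩ := hF
    simp only [circAvg_density_eq hp hq] at hint heq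
    rw [hLf, heq, intervalIntegral.integral_const_mul]
    have hs2 : √2 ≠ 0 := by positivity
    have hs6 : √6 ≠ 0 := by positivity
    have hq2 : √2 ^ 2 = 2 := Real.sq_sqrt (by norm_num)
    have hq6 : √6 ^ 2 = 6 := Real.sq_sqrt (by norm_num)
    have du := fun r (hr : r ∈ Ioc 0 R₁) =>
      hasDerivAt_of_contDiffOn_two (isOpen_Iset R) hsol.smooth_u (hsub hr)
    have dv := fun r (hr : r ∈ Ioc 0 R₁) =>
      hasDerivAt_of_contDiffOn_two (isOpen_Iset R) hsol.smooth_v (hsub hr)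
    have hpos := integral_angularEnergy_pos hkR hR₀ le_rfl hD0 (V := V) (κ := κ)
      (ψ₀ := fun r => -3 / √6 * v r) (ψ₀' := fun r => -3 / √6 * deriv v r)
      (ψ₀'' := fun r => -3 / √6 * deriv (deriv v) r)
      (ψ₁ := fun r => 1 / √2 * u r) (ψ₁' := fun r => 1 / √2 * deriv u r)
      (ψ₁'' := fun r => 1 / √2 * deriv (deriv u) r)
      hp hq hVc hκc (fun r hr => (le_abs_self _).trans (hD r hr))
      (fun r hr => by have := hu r (hsub hr); positivity)
      (fun r hr => mul_pos_of_neg_of_neg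
        (div_neg_of_neg_of_pos (by norm_num) (by positivity)) (hv r (hsub hr)))
      (fun r hr => by have := hu r (hsub hr); positivity)
      (fun r hr => (dv r hr).1.const_mul _) (fun r hr => (du r hr).1.const_mul _)
      (fun r hr => (dv r hr).2.const_mul _) (fun r hr => (du r hr).2.const_mul _)
      ?_ ?_ ?_ ?_ ?_ ?_
    · positivity
    · intro r hr
      have h := hsol.ode_v r (hsub hr)
      have hr0 := hr.1.ne'
      rw [gfun] at h
      have h' : r ^ 2 * deriv (deriv v) r + r * deriv v r = r ^ 2 *
          (v r * (-a2 - b2 / √6 * v r + c2 * (u r ^ 2 + v r ^ 2)) + b2 / √6 * u r ^ 2) := by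
        rw [← h]; field_simp
      have e : 3 / √6 * (b2 / √6 * u r ^ 2) = b2 * (u r / √2) * (1 / √2 * u r) := by
        field_simp
        rw [hq2, hq6]
        ring
      simp only [hVdef, hκdef]
      linear_combination (-3 / √6) * h' - r ^ 2 * e
    · intro r hr
      have h := hsol.ode_u r (hsub hr)
      have hr0 := hr.1.ne'
      rw [hfun, hk2] at h
      have h' : r ^ 2 * deriv (deriv u) r + r * deriv u r - u r = r ^ 2 *
          (u r * (-a2 + 2 * b2 / √6 * v r + c2 * (u r ^ 2 + v r ^ 2))) := by
        rw [← h]; field_simp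
      simp only [hVdef, hκdef]
      linear_combination (1 / √2) * h'
    · simpa using hint.const_mul (1 / 2)
    · intro θ
      simp [hvan (polarPt R₁ θ) (by rw [norm_polarPt]; exact le_abs_self _)]
    · intro θ
      simp [hvan (polarPt R₁ θ) (by rw [norm_polarPt]; exact le_abs_self _)]
    · have cS : Continuous fun x => P x 0 2 ^ 2 + P x 1 2 ^ 2 :=
        ((hsmooth 0 2).continuous.pow 2).add ((hsmooth 1 2).continuous.pow 2)
      obtain ⟨x₀, hx₀⟩ : ∃ x, 0 < P x 0 2 ^ 2 + P x 1 2 ^ 2 := by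
        by_contra! hcon
        refine hPne (funext fun x => ?_)
        have h0 : P x 0 2 = 0 := by nlinarith [hcon x, sq_nonneg (P x 0 2), sq_nonneg (P x 1 2)]
        have h1 : P x 1 2 = 0 := by nlinarith [hcon x, sq_nonneg (P x 0 2), sq_nonneg (P x 1 2)]
        rw [hform x, h0, h1]
        ext i j
        fin_cases i <;> fin_cases j <;> rfl
      obtain ⟨x, hx, hx0⟩ := (dense_compl_singleton
        (0 : EuclideanSpace ℝ (Fin 2))).inter_open_nonempty _
          (isOpen_lt continuous_const cS) ⟨x₀, hx₀⟩
      have hxn : ‖x‖ < R₁ := by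
        by_contra! hcon
        have hx : 0 < P x 0 2 ^ 2 + P x 1 2 ^ 2 := hx
        simp [hvan x hcon] at hx
      obtain ⟨θ, hθ, hxθ⟩ := exists_polarPt_eq x
      refine ⟨‖x‖, ⟨norm_pos_iff.2 hx0, hxn⟩,
        circAvg_pos ((hp.cont_slice _).pow 2 |>.add ((hq.cont_slice _).pow 2))
          (fun θ => by positivity) hθ ?_⟩
      simp only [hxθ]
      exact hx
  · intro r hr θ
    have h0 := radialDeriv_sq_add (fun x => P x 0 2) hr.1.ne' θ
    have h1 := radialDeriv_sq_add (fun x => P x 1 2) hr.1.ne' θ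
    rw [mul_secondVariationDensity_polarPt hk hform hr.1, gradSq_of_offDiag hform, ← h0, ← h1]
    have hr0 := hr.1.ne'
    simp only [hVdef, hκdef]
    field_simp
    ring
  · have c := continuous_polarPt
    have c0 := (hsmooth 0 2).continuous.comp c
    have c1 := (hsmooth 1 2).continuous.comp c
    have d0 := fun α => (continuous_partialDeriv (hsmooth 0 2) α).comp c
    have d1 := fun α => (continuous_partialDeriv (hsmooth 1 2) α).comp c
    simp only [Function.comp_def] at c0 c1 d0 d1
    have i0 := integrableOn_mul_of_bounded (W := fun _ => 1) (R₁ := R₁) (D := 1)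
      (B := fun r θ => r * gradSq P (polarPt r θ)) continuousOn_const (fun _ _ => by simp)
      (by simp only [gradSq_of_offDiag hform]
          have := d0 0
          have := d0 1
          have := d1 0
          have := d1 1
          fun_prop)
    have i1 := integrableOn_mul_of_bounded
      (B := fun r θ => 2 * (r * (P (polarPt r θ) 0 2 ^ 2 + P (polarPt r θ) 1 2 ^ 2))) hVc
      (fun r hr => hD r (Ioo_subset_Ioc_self hr)) (by fun_prop)
    have i2 := integrableOn_mul_of_bounded
      (B := fun r θ => 2 * (r * (cos θ * (P (polarPt r θ) 0 2 ^ 2 - P (polarPt r θ) 1 2 ^ 2)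
          + 2 * k * (sin θ * (P (polarPt r θ) 0 2 * P (polarPt r θ) 1 2))))) hκc
      hCκ (by fun_prop)
    refine ((i0.add i1).sub i2).congr_fun ?_ (measurableSet_Ioo.prod measurableSet_Ioo)
    intro y hy
    have h0 := radialDeriv_sq_add (fun x => P x 0 2) hy.1.1.ne' y.2
    have h1 := radialDeriv_sq_add (fun x => P x 1 2) hy.1.1.ne' y.2
    have hr0 := hy.1.1.ne'
    simp only [Pi.add_apply, Pi.sub_apply, gradSq_of_offDiag hform, ← h0, ← h1]
    field_simp
    ring

end
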